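/- arXiv:1508.07203 — 3 statements merged into one kernel-verified Lean document; each statement's English description precedes it below -/
import Mathlib

section
/- Let V be a finite-dimensional module over sl(n+1) ⋉ C^{n+1} and v_μ ∈ V a highest weight vector for sl(n+1) of dominant integral weight μ. Then the lowering operators φ_i commute on highest weight vectors: φ_i(φ_j(v_μ)) = φ_j(φ_i(v_μ)) for all 1 ≤ i, j ≤ n+1. -/
open Module

namespace Paper

/-- The pairing `(α_i, α_{p,q})` (value of the root `α_{p,q} = α_p + ⋯ + α_q`
on the coroot `H_i`) for `sl`, in the paper's normalization. -/
def pair (i p q : ℕ) : ℤ :=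
  (if i = p then 1 else 0) + (if i = q then 1 else 0)
    - (if i + 1 = p then 1 else 0) - (if i = q + 1 then 1 else 0)

/-- A module over `sl(N+1, ℂ)`, described through the action of the Chevalley-type
generators `H_i` (`1 ≤ i ≤ N`), `E_{p,q}`, `F_{p,q}` (`1 ≤ p ≤ q ≤ N`), subject to the
structure relations (2.7) of the paper.  Indices outside the valid ranges are junk. -/
structure SLRep (N : ℕ) (M : Type) [AddCommGroup M] [Module ℂ M] where
  H : ℕ → Module.End ℂ M
  E : ℕ → ℕ → Module.End ℂ M
  F : ℕ → ℕ → Module.End ℂ M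
  hHH : ∀ i j, 1 ≤ i → i ≤ N → 1 ≤ j → j ≤ N → ⁅H i, H j⁆ = 0
  hHE : ∀ i p q, 1 ≤ i → i ≤ N → 1 ≤ p → p ≤ q → q ≤ N →
    ⁅H i, E p q⁆ = ((pair i p q : ℤ) : ℂ) • E p q
  hHF : ∀ i p q, 1 ≤ i → i ≤ N → 1 ≤ p → p ≤ q → q ≤ N →
    ⁅H i, F p q⁆ = -(((pair i p q : ℤ) : ℂ)) • F p q
  hEE : ∀ p q r s, 1 ≤ p → p ≤ q → q ≤ N → 1 ≤ r → r ≤ s → s ≤ N →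
    ⁅E p q, E r s⁆ = (if q + 1 = r then E p s else 0) - (if p = s + 1 then E r q else 0)
  hFF : ∀ p q r s, 1 ≤ p → p ≤ q → q ≤ N → 1 ≤ r → r ≤ s → s ≤ N →
    ⁅F p q, F r s⁆ = (if p = s + 1 then F r q else 0) - (if q + 1 = r then F p s else 0)
  hEF : ∀ p q r s, 1 ≤ p → p ≤ q → q ≤ N → 1 ≤ r → r ≤ s → s ≤ N →
    ⁅E p q, F r s⁆ =
      (if p = r ∧ q = s then ∑ t ∈ Finset.Icc p q, H t else 0)
      + (if p = r ∧ q < s then -F (q + 1) s else 0)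
      + (if p = r ∧ s < q then -E (s + 1) q else 0)
      + (if q = s ∧ p < r then E p (r - 1) else 0)
      + (if q = s ∧ r < p then F r (p - 1) else 0)

/-- A module over the perfect Lie algebra `sl(n+1) ⋉ ℂ^{n+1}`:
an `sl(n+1)`-module together with the action of the radical generators
`P_j` (`1 ≤ j ≤ n+1`), subject to the remaining relations of (2.7). -/
structure SLPRep (n : ℕ) (M : Type) [AddCommGroup M] [Module ℂ M] extends SLRep n M where
  P : ℕ → Module.End ℂ M
  hHP : ∀ i j, 1 ≤ i → i ≤ n → 1 ≤ j → j ≤ n + 1 →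
    ⁅H i, P j⁆ = (((if i = j then 1 else 0) - (if i + 1 = j then 1 else 0) : ℤ) : ℂ) • P j
  hEP : ∀ p q j, 1 ≤ p → p ≤ q → q ≤ n → 1 ≤ j → j ≤ n + 1 →
    ⁅E p q, P j⁆ = if q + 1 = j then P p else 0
  hFP : ∀ p q j, 1 ≤ p → p ≤ q → q ≤ n → 1 ≤ j → j ≤ n + 1 →
    ⁅F p q, P j⁆ = if p = j then P (q + 1) else 0
  hPP : ∀ i j, 1 ≤ i → i ≤ n + 1 → 1 ≤ j → j ≤ n + 1 → ⁅P i, P j⁆ = 0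

/-- `μ_{k,s} = -((μ_k + 1) + ⋯ + (μ_s + 1))` (Definition 3.4). -/
def mus (μ : ℕ → ℤ) (k s : ℕ) : ℤ := -(∑ i ∈ Finset.Icc k s, (μ i + 1))

section Alg

variable {A : Type} [Ring A] [Algebra ℂ A]

/-- `F^{(μ(s))}_{i,j} = (∏_{k=i+1}^{j} μ_{k,s}) F_{i,j}` (Definition 3.6). -/
def Fm (F : ℕ → ℕ → A) (μ : ℕ → ℤ) (s i j : ℕ) : A :=
  (((∏ k ∈ Finset.Icc (i + 1) j, mus μ k s : ℤ)) : ℂ) • F i j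

/-- `P^{(μ(s))}_{i} = (∏_{k=1}^{i-1} μ_{k,s-1}) P_i` (Definition 3.6). -/
def Pm (P : ℕ → A) (μ : ℕ → ℤ) (s i : ℕ) : A :=
  (((∏ k ∈ Finset.Icc 1 (i - 1), mus μ k (s - 1) : ℤ)) : ℂ) • P i

/-- The elements `Q^{(μ(s))}_k` of Definition 3.7, defined by the recursion
`Q^{(μ(s))}_{s+1} = 1`, `Q^{(μ(s))}_{s-k} = ∑_{l=0}^{k} Q^{(μ(s))}_{s-l+1} F^{(μ(s))}_{s-k,s-l}`. -/
noncomputable def Qop (F : ℕ → ℕ → A) (μ : ℕ → ℤ) (s k : ℕ) : A :=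
  if s + 1 ≤ k then 1
  else ∑ l ∈ (Finset.range (s + 1 - k)).attach,
      Qop F μ s (s - l.1 + 1) * Fm F μ s k (s - l.1)
termination_by s + 1 - k
decreasing_by
  have := l.2; simp only [Finset.mem_range] at this; omega

/-- The elements `R^{(μ(s))}_{i,k}` of Definition 3.8:
`R^{(μ(s))}_{i,0} = 1`, `R^{(μ(s))}_{i,k} = ∑_{l=0}^{k-1} F^{(μ(s))}_{i+l,i+k-1} R^{(μ(s))}_{i,l}`. -/
noncomputable def Rop (F : ℕ → ℕ → A) (μ : ℕ → ℤ) (s i : ℕ) : ℕ → A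
  | 0 => 1
  | k + 1 => ∑ l ∈ (Finset.range (k + 1)).attach,
      Fm F μ s (i + l.1) (i + k) * Rop F μ s i l.1
termination_by k => k
decreasing_by
  have := l.2; simp only [Finset.mem_range] at this; omega

end Alg

variable {M : Type} [AddCommGroup M] [Module ℂ M]

/-- The operator `φ_i` at weight `μ`:
`φ_i = P^{(μ(i))}_i + ∑_{k=1}^{i-1} Q^{(μ(i-1))}_k P^{(μ(i))}_k` (Theorem 3.12). -/
noncomputable def PhiOp (F : ℕ → ℕ → Module.End ℂ M) (P : ℕ → Module.End ℂ M)
    (μ : ℕ → ℤ) (i : ℕ) : Module.End ℂ M :=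
  Pm P μ i i + ∑ k ∈ Finset.Icc 1 (i - 1), Qop F μ (i - 1) k * Pm P μ i k

/-- The weight shift `μ ↦ μ + ω_i - ω_{i-1}` in fundamental-weight coordinates. -/
def wsh (i : ℕ) (μ : ℕ → ℤ) : ℕ → ℤ := fun l =>
  μ l + (if l = i then 1 else 0) - (if l + 1 = i then 1 else 0)

/-- `v` is a highest weight vector of weight `μ` for the `sl(N+1)`-action. -/
def IsHWvec (N : ℕ) (Hop : ℕ → Module.End ℂ M) (Eop : ℕ → ℕ → Module.End ℂ M)
    (μ : ℕ → ℤ) (v : M) : Prop :=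
  (∀ i, 1 ≤ i → i ≤ N → Hop i v = ((μ i : ℤ) : ℂ) • v) ∧
  (∀ p q, 1 ≤ p → p ≤ q → q ≤ N → Eop p q v = 0)

/-- Successively apply the operators `φ_i`, for `i` running through a list,
keeping track of the weight shifts. -/
noncomputable def phiList (F : ℕ → ℕ → Module.End ℂ M) (P : ℕ → Module.End ℂ M) :
    List ℕ → (ℕ → ℤ) → M → M
  | [], _, v => v
  | i :: L, μ, v => phiList F P L (wsh i μ) (PhiOp F P μ i v)

/-- Turn a list of exponents `[k_1, …, k_r]` (starting label `j`) into the list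
`j, …, j (k_1 times), j+1, …`; applying `phiList` along it computes
`φ_{j+r-1}^{k_r}(⋯(φ_j^{k_1}(v))⋯)`. -/
def expList : List ℕ → ℕ → List ℕ
  | [], _ => []
  | m :: iv, j => List.replicate m j ++ expList iv (j + 1)

/-- The list encoding `φ_{k-1}^{i_{k-1}}(⋯(φ_1^{i_1}(v))⋯)` for the exponents `i_1, …, i_{k-1}`. -/
def evec (k : ℕ) (iv : ℕ → ℕ) : List ℕ :=
  (List.range (k - 1)).flatMap fun t => List.replicate (iv (t + 1)) (t + 1)

/-- A submodule is invariant under the `sl(N+1)`-action. -/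
def slInvariant (N : ℕ) (Hop : ℕ → Module.End ℂ M) (Eop Fop : ℕ → ℕ → Module.End ℂ M)
    (Ns : Submodule ℂ M) : Prop :=
  (∀ i, 1 ≤ i → i ≤ N → ∀ v ∈ Ns, Hop i v ∈ Ns) ∧
  (∀ p q, 1 ≤ p → p ≤ q → q ≤ N → ∀ v ∈ Ns, Eop p q v ∈ Ns ∧ Fop p q v ∈ Ns)

/-- A submodule is invariant under the full `sl(n+1) ⋉ ℂ^{n+1}`-action. -/
def gInvariant (n : ℕ) (Hop : ℕ → Module.End ℂ M) (Eop Fop : ℕ → ℕ → Module.End ℂ M)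
    (Pop : ℕ → Module.End ℂ M) (Ns : Submodule ℂ M) : Prop :=
  slInvariant n Hop Eop Fop Ns ∧ ∀ j, 1 ≤ j → j ≤ n + 1 → ∀ v ∈ Ns, Pop j v ∈ Ns

/-- `U(sl(N+1))·v`: the smallest `sl(N+1)`-invariant subspace containing `v`. -/
def slGen (N : ℕ) (Hop : ℕ → Module.End ℂ M) (Eop Fop : ℕ → ℕ → Module.End ℂ M)
    (v : M) : Submodule ℂ M :=
  sInf {Ns | slInvariant N Hop Eop Fop Ns ∧ v ∈ Ns}

/-- `U(sl(n+1) ⋉ ℂ^{n+1})·v`. -/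
def gGen (n : ℕ) (Hop : ℕ → Module.End ℂ M) (Eop Fop : ℕ → ℕ → Module.End ℂ M)
    (Pop : ℕ → Module.End ℂ M) (v : M) : Submodule ℂ M :=
  sInf {Ns | gInvariant n Hop Eop Fop Pop Ns ∧ v ∈ Ns}

end Paper

namespace Paper

section Helper

variable {A : Type} [Ring A] [Algebra ℂ A]

/-- Level-wise construction of the lowering operators. -/
noncomputable def XS (F : ℕ → ℕ → A) (P : ℕ → A) (a : ℕ → ℂ) (x : ℂ) : ℕ → ℕ → A
  | 0, p => P p
  | k + 1, p => (x - a (k + 1)) • XS F P a x k p + F (k + 1) (p - 1) * XS F P a x k (k + 1)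

theorem XS_succ (F : ℕ → ℕ → A) (P : ℕ → A) (a : ℕ → ℂ) (x : ℂ) (k p : ℕ) :
    XS F P a x (k + 1) p =
      (x - a (k + 1)) • XS F P a x k p + F (k + 1) (p - 1) * XS F P a x k (k + 1) := rfl

theorem XS_congr (F : ℕ → ℕ → A) (P : ℕ → A) (a b : ℕ → ℂ) (x : ℂ) (k : ℕ) :
    (∀ t, t ≤ k → a t = b t) → ∀ p, XS F P a x k p = XS F P b x k p := by
  induction k with
  | zero => intro _ p; rfl
  | succ k ih =>
    intro h p
    rw [XS_succ, XS_succ, ih (fun t ht => h t (by omega)), ih (fun t ht => h t (by omega)),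
      h (k + 1) le_rfl]

/-- the relations needed -/
structure Rel (n : ℕ) (F : ℕ → ℕ → A) (P : ℕ → A) : Prop where
  FF0 : ∀ p q r s, 1 ≤ p → p ≤ q → q ≤ n → 1 ≤ r → r ≤ s → s ≤ n → p ≠ s + 1 → q + 1 ≠ r →
    F p q * F r s = F r s * F p q
  FF1 : ∀ p q r, 1 ≤ r → r < p → p ≤ q → q ≤ n →
    F p q * F r (p - 1) = F r (p - 1) * F p q + F r q
  FP0 : ∀ p q j, 1 ≤ p → p ≤ q → q ≤ n → 1 ≤ j → j ≤ n + 1 → p ≠ j → F p q * P j = P j * F p q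
  FP1 : ∀ p q, 1 ≤ p → p ≤ q → q ≤ n → F p q * P p = P p * F p q + P (q + 1)
  PP : ∀ i j, 1 ≤ i → i ≤ n + 1 → 1 ≤ j → j ≤ n + 1 → P i * P j = P j * P i

variable {n : ℕ} {F : ℕ → ℕ → A} {P : ℕ → A}

theorem comm0 (R : Rel n F P) (a : ℕ → ℂ) (x : ℂ) (K p : ℕ) (hKp : K < p) (hp : p ≤ n + 1) (k : ℕ) :
    k < K → ∀ q, k < q → q ≠ K → q ≤ n + 1 →
      F K (p - 1) * XS F P a x k q = XS F P a x k q * F K (p - 1) := by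
  induction k with
  | zero =>
    intro hk q hq hqK hqn
    exact R.FP0 K (p - 1) q (by omega) (by omega) (by omega) (by omega) (by omega) (by omega)
  | succ k ih =>
    intro hk q hq hqK hqn
    have h1 := ih (by omega) q (by omega) hqK hqn
    have h2 := ih (by omega) (k + 1) (by omega) (by omega) (by omega)
    have h3 := R.FF0 K (p - 1) (k + 1) (q - 1) (by omega) (by omega) (by omega) (by omega)
      (by omega) (by omega) (by omega) (by omega)
    rw [XS_succ, mul_add, add_mul, mul_smul_comm, smul_mul_assoc, h1, ← mul_assoc, h3, mul_assoc,
      h2, mul_assoc]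

theorem comm1 (R : Rel n F P) (a : ℕ → ℂ) (x : ℂ) (K p : ℕ) (hKp : K < p) (hp : p ≤ n + 1) (k : ℕ) :
    k < K →
      F K (p - 1) * XS F P a x k K = XS F P a x k K * F K (p - 1) + XS F P a x k p := by
  induction k with
  | zero =>
    intro hk
    have := R.FP1 K (p - 1) (by omega) (by omega) (by omega)
    rwa [show p - 1 + 1 = p by omega] at this
  | succ k ih =>
    intro hk
    have h1 := ih (by omega)
    have h2 := comm0 R a x K p hKp hp k (by omega) (k + 1) (by omega) (by omega) (by omega)
    have h3 := R.FF1 K (p - 1) (k + 1) (by omega) (by omega) (by omega) (by omega)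
    rw [XS_succ, XS_succ, mul_add, add_mul, mul_smul_comm, smul_mul_assoc, h1, ← mul_assoc, h3,
      add_mul, mul_assoc, h2, mul_assoc, smul_add]
    abel

theorem step (X X' B B' C C' e f : A) (u w : ℂ)
    (ef : f * e = e * f)
    (eX' : e * X' = X' * e) (eX : e * X = X * e) (fX : f * X = X * f) (fX' : f * X' = X' * f)
    (eB' : e * B' = B' * e) (eB : e * B = B * e)
    (fB : f * B = B * f) (fB' : f * B' = B' * f)
    (eC : e * C = C * e + X) (eC' : e * C' = C' * e + X')
    (fC : f * C = C * f + B) (fC' : f * C' = C' * f + B')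
    (CC : C * C' = C' * C)
    (R1 : (u - w) • (X * B' - B' * X) = X * B' - X' * B)
    (R2 : (u - w) • (X * C' - C' * X) = X * C' - X' * C)
    (R3 : (u - w) • (B * C' - C' * B) = B * C' - B' * C)
    (R4 : (u - w) • (C * B' - B' * C) = C * B' - C' * B)
    (S1 : X * B' - B' * X = X' * B - B * X')
    (S2 : X * C' - C' * X = X' * C - C * X')
    (S3 : B * C' - C' * B = B' * C - C * B') :
    (u - w) • ((u • X + e * C) * (w • B' + f * C') - (w • B' + f * C') * (u • X + e * C))
      = (u • X + e * C) * (w • B' + f * C') - (w • X' + e * C') * (u • B + f * C) ∧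
    (u • X + e * C) * (w • B' + f * C') - (w • B' + f * C') * (u • X + e * C)
      = (w • X' + e * C') * (u • B + f * C) - (u • B + f * C) * (w • X' + e * C') := by
  have a1 : X * (f * C') = f * (X * C') := by rw [← mul_assoc, ← fX, mul_assoc]
  have a1' : X' * (f * C) = f * (X' * C) := by rw [← mul_assoc, ← fX', mul_assoc]
  have a2 : B' * (e * C) = e * (B' * C) := by rw [← mul_assoc, ← eB', mul_assoc]
  have a2' : B * (e * C') = e * (B * C') := by rw [← mul_assoc, ← eB, mul_assoc]
  have a3 : C * (f * C') = f * (C * C') - B * C' := by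
    rw [← mul_assoc, ← mul_assoc, fC, add_mul]; abel
  have a3' : C' * (f * C) = f * (C * C') - B' * C := by
    rw [CC, ← mul_assoc, ← mul_assoc, fC', add_mul]; abel
  have a4 : C' * (e * C) = e * (C * C') - X' * C := by
    rw [CC, ← mul_assoc, ← mul_assoc, eC', add_mul]; abel
  have a4' : C * (e * C') = e * (C * C') - X * C' := by
    rw [← mul_assoc, ← mul_assoc, eC, add_mul]; abel
  have a5 : f * (e * (C * C')) = e * (f * (C * C')) := by rw [← mul_assoc, ef, mul_assoc]
  have r2 := congrArg (f * ·) R2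
  have r3 := congrArg (e * ·) R3
  have r4 := congrArg (e * ·) R4
  have s2 := congrArg (f * ·) S2
  have s3 := congrArg (e * ·) S3
  simp only [mul_add, add_mul, smul_mul_assoc, mul_smul_comm, mul_assoc, a1, a1', a2, a2',
    a3, a3', a4, a4', a5, mul_sub] at *
  constructor
  · linear_combination (norm := module) (u * w) • R1 + u • r2 + w • r4 - r3
  · linear_combination (norm := module) (u * w) • S1 + r2 + w • s2 + r3 + w • s3

theorem RS (R : Rel n F P) (a : ℕ → ℂ) (k : ℕ) :
    ∀ p q, k < p → k < q → p ≤ n + 1 → q ≤ n + 1 → ∀ x y : ℂ,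
      (x - y) • (XS F P a x k p * XS F P a y k q - XS F P a y k q * XS F P a x k p)
        = XS F P a x k p * XS F P a y k q - XS F P a y k p * XS F P a x k q ∧
      XS F P a x k p * XS F P a y k q - XS F P a y k q * XS F P a x k p
        = XS F P a y k p * XS F P a x k q - XS F P a x k q * XS F P a y k p := by
  induction k with
  | zero =>
    intro p q hp hq hpn hqn x y
    have := R.PP p q (by omega) hpn (by omega) hqn
    simp [XS, this]
  | succ k ih =>
    intro p q hp hq hpn hqn x y
    simp only [XS_succ]
    have hxy : x - y = (x - a (k+1)) - (y - a (k+1)) := by ring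
    have hcc := (ih (k+1) (k+1) (by omega) (by omega) (by omega) (by omega) x y).2
    have CC : XS F P a x k (k+1) * XS F P a y k (k+1) = XS F P a y k (k+1) * XS F P a x k (k+1) := by
      have h2 : (2:ℂ) • (XS F P a x k (k+1) * XS F P a y k (k+1)
          - XS F P a y k (k+1) * XS F P a x k (k+1)) = 0 := by
        linear_combination (norm := module) hcc
      exact sub_eq_zero.1 ((smul_eq_zero.1 h2).resolve_left two_ne_zero)
    rw [hxy]
    apply step
    · exact (R.FF0 (k+1) (q-1) (k+1) (p-1) (by omega) (by omega) (by omega) (by omega)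
        (by omega) (by omega) (by omega) (by omega))
    · exact comm0 R a y (k+1) p hp hpn k (by omega) p (by omega) (by omega) hpn
    · exact comm0 R a x (k+1) p hp hpn k (by omega) p (by omega) (by omega) hpn
    · exact comm0 R a x (k+1) q hq hqn k (by omega) p (by omega) (by omega) hpn
    · exact comm0 R a y (k+1) q hq hqn k (by omega) p (by omega) (by omega) hpn
    · exact comm0 R a y (k+1) p hp hpn k (by omega) q (by omega) (by omega) hqn
    · exact comm0 R a x (k+1) p hp hpn k (by omega) q (by omega) (by omega) hqn
    · exact comm0 R a x (k+1) q hq hqn k (by omega) q (by omega) (by omega) hqn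
    · exact comm0 R a y (k+1) q hq hqn k (by omega) q (by omega) (by omega) hqn
    · exact comm1 R a x (k+1) p hp hpn k (by omega)
    · exact comm1 R a y (k+1) p hp hpn k (by omega)
    · exact comm1 R a x (k+1) q hq hqn k (by omega)
    · exact comm1 R a y (k+1) q hq hqn k (by omega)
    · exact CC
    · rw [← hxy]; exact (ih p q (by omega) (by omega) hpn hqn x y).1
    · rw [← hxy]; exact (ih p (k+1) (by omega) (by omega) hpn (by omega) x y).1
    · rw [← hxy]; exact (ih q (k+1) (by omega) (by omega) hqn (by omega) x y).1
    · rw [← hxy]; exact (ih (k+1) q (by omega) (by omega) (by omega) hqn x y).1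
    · exact (ih p q (by omega) (by omega) hpn hqn x y).2
    · exact (ih p (k+1) (by omega) (by omega) hpn (by omega) x y).2
    · exact (ih q (k+1) (by omega) (by omega) hqn (by omega) x y).2

theorem exch (R : Rel n F P) (a b : ℕ → ℂ) (j : ℕ) (x : ℂ) (hb : b (j+1) = a (j+1) + 1)
    (hb' : ∀ t, t ≠ j+1 → b t = a t) (d : ℕ) :
    ∀ p, j + 1 + d < p → p ≤ n + 1 →
      XS F P b x (j+1+d) p * XS F P a (a (j+1)) j (j+1)
        = XS F P a (a (j+1)) j (j+1) * XS F P a x (j+1+d) p := by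
  induction d with
  | zero =>
    intro p hp hpn
    have hba : ∀ q, XS F P b x j q = XS F P a x j q :=
      XS_congr F P b a x j (fun t ht => hb' t (by omega))
    have hR := (RS R a j p (j+1) (by omega) (by omega) hpn (by omega) x (a (j+1))).1
    have hcc := (RS R a j (j+1) (j+1) (by omega) (by omega) (by omega) (by omega) x (a (j+1))).2
    have e1 := comm1 R a (a (j+1)) (j+1) p hp hpn j (by omega)
    rw [add_zero, XS_succ, XS_succ, hba, hba, hb]
    generalize XS F P a x j p = X at *
    generalize XS F P a x j (j+1) = C at *
    generalize XS F P a (a (j+1)) j (j+1) = C' at *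
    generalize XS F P a (a (j+1)) j p = X' at *
    generalize F (j+1) (p-1) = e at *
    have hc2 : (2:ℂ) • (C * C' - C' * C) = 0 := by
      linear_combination (norm := module) hcc
    have CC := sub_eq_zero.1 ((smul_eq_zero.1 hc2).resolve_left two_ne_zero)
    have a4 : C' * (e * C) = e * (C * C') - X' * C := by
      rw [CC, ← mul_assoc, ← mul_assoc, e1, add_mul]; abel
    simp only [mul_add, add_mul, smul_mul_assoc, mul_smul_comm, mul_assoc, a4]
    linear_combination (norm := module) hR
  | succ d ih =>
    intro p hp hpn
    have h1 := ih p (by omega) hpn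
    have h2 := ih (j+1+d+1) (by omega) (by omega)
    have h3 := comm0 R a (a (j+1)) (j+1+d+1) p (by omega) hpn j (by omega) (j+1) (by omega)
      (by omega) (by omega)
    rw [show j + 1 + (d+1) = j+1+d+1 by omega, XS_succ, XS_succ, hb' (j+1+d+1) (by omega),
      add_mul, mul_add, smul_mul_assoc, mul_smul_comm, h1, mul_assoc, h2, ← mul_assoc, h3,
      mul_assoc]

/-- partial sums of the shifted weight -/
def asum (μ : ℕ → ℤ) (k : ℕ) : ℤ := -∑ l ∈ Finset.range k, (μ l + 1)

theorem mus_eq (μ : ℕ → ℤ) (k s : ℕ) (h : k ≤ s + 1) : mus μ k s = asum μ (s+1) - asum μ k := by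
  unfold mus asum
  have : Finset.Icc k s = Finset.Ico k (s+1) := by
    ext t; simp only [Finset.mem_Icc, Finset.mem_Ico, Finset.mem_Ioc]; omega
  rw [this, Finset.sum_Ico_eq_sub _ h]
  ring

theorem asum_wsh (μ : ℕ → ℤ) (j k : ℕ) :
    asum (wsh (j+1) μ) k = asum μ k + if k = j + 1 then 1 else 0 := by
  induction k with
  | zero => simp [asum]
  | succ k ih =>
    have h1 : ∀ ν : ℕ → ℤ, asum ν (k+1) = asum ν k - (ν k + 1) := by
      intro ν; unfold asum; rw [Finset.sum_range_succ]; ring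
    rw [h1, h1, ih]
    unfold wsh
    split_ifs <;> first | omega | ring

theorem Qop_ge (F : ℕ → ℕ → A) (μ : ℕ → ℤ) (s : ℕ) : Qop F μ s (s+1) = 1 := by
  rw [Qop]; simp

theorem Qop_lt (F : ℕ → ℕ → A) (μ : ℕ → ℤ) (s k : ℕ) (h : k ≤ s) :
    Qop F μ s k = ∑ p ∈ Finset.Icc (k+1) (s+1), Qop F μ s p * Fm F μ s k (p-1) := by
  rw [Qop, if_neg (by omega),
    Finset.sum_attach (Finset.range (s+1-k)) (fun l => Qop F μ s (s - l + 1) * Fm F μ s k (s - l))]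
  apply Finset.sum_bij' (fun l _ => s - l + 1) (fun p _ => s + 1 - p)
  · intro l hl; simp at hl ⊢; omega
  · intro l hl; simp at hl ⊢; omega
  · intro l hl; simp at hl ⊢; omega
  · intro l hl; simp at hl ⊢; omega
  · intro l hl; simp

theorem level (F : ℕ → ℕ → A) (P : ℕ → A) (μ : ℕ → ℤ) (s : ℕ) (r : ℕ) (hr : r ≤ s) :
    ∑ p ∈ Finset.Icc 1 (s+1), (((∏ k ∈ Finset.Icc 1 (p-1), mus μ k s : ℤ)) : ℂ) •
      (Qop F μ s p * P p) =
    ∑ p ∈ Finset.Icc (r+1) (s+1), (((∏ k ∈ Finset.Icc (r+1) (p-1), mus μ k s : ℤ)) : ℂ) •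
      (Qop F μ s p * XS F P (fun k => (asum μ k : ℂ)) (asum μ (s+1)) r p) := by
  induction r with
  | zero => rfl
  | succ r ih =>
    rw [ih (by omega), ← Finset.add_sum_Ioc_eq_sum_Icc (by omega : r + 1 ≤ s + 1)]
    have hI : Finset.Ioc (r+1) (s+1) = Finset.Icc (r+1+1) (s+1) := by
      ext t; simp only [Finset.mem_Icc, Finset.mem_Ico, Finset.mem_Ioc]; omega
    rw [hI]
    have h0 : Finset.Icc (r+1) (r+1-1) = ∅ := by ext t; simp
    rw [h0, Finset.prod_empty, Int.cast_one, one_smul, Qop_lt F μ s (r+1) hr, Finset.sum_mul,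
      ← Finset.sum_add_distrib]
    apply Finset.sum_congr rfl
    intro p hp
    rw [Finset.mem_Icc] at hp
    have hJ : Finset.Icc (r+1) (p-1) = insert (r+1) (Finset.Icc (r+1+1) (p-1)) := by
      ext t; simp only [Finset.mem_insert, Finset.mem_Icc]; omega
    rw [hJ, Finset.prod_insert (by simp), XS_succ, mus_eq μ (r+1) s (by omega), Fm]
    push_cast
    simp only [mul_add, mul_smul_comm, smul_mul_assoc, mul_assoc]
    module

theorem asum_cast_wsh (μ : ℕ → ℤ) (j k : ℕ) :
    ((asum (wsh (j+1) μ) k : ℤ) : ℂ) = (asum μ k : ℂ) + if k = j + 1 then 1 else 0 := by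
  rw [asum_wsh]; push_cast; rfl

end Helper

theorem PhiOp_eq {M : Type} [AddCommGroup M] [Module ℂ M] (F : ℕ → ℕ → Module.End ℂ M)
    (P : ℕ → Module.End ℂ M) (μ : ℕ → ℤ) (s : ℕ) :
    PhiOp F P μ (s+1) = XS F P (fun k => (asum μ k : ℂ)) (asum μ (s+1)) s (s+1) := by
  have h := level F P μ s s le_rfl
  rw [Finset.Icc_self, Finset.sum_singleton] at h
  simp only [add_tsub_cancel_right] at h
  have h0 : Finset.Icc (s+1) s = ∅ := by ext t; simp
  rw [h0, Finset.prod_empty, Int.cast_one, one_smul, Qop_ge, one_mul] at h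
  rw [← h]
  have hJ : Finset.Icc 1 (s+1) = insert (s+1) (Finset.Icc 1 s) := by
    ext t; simp only [Finset.mem_insert, Finset.mem_Icc]; omega
  rw [hJ, Finset.sum_insert (by simp), Qop_ge, one_mul]
  unfold PhiOp Pm
  simp only [add_tsub_cancel_right, mul_smul_comm]

theorem toRel {n : ℕ} {M : Type} [AddCommGroup M] [Module ℂ M] (ρ : SLPRep n M) :
    Rel n ρ.F ρ.P where
  FF0 p q r s h1 h2 h3 h4 h5 h6 h7 h8 := by
    have := ρ.hFF p q r s h1 h2 h3 h4 h5 h6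
    rw [if_neg h7, if_neg h8, sub_zero, Ring.lie_def] at this
    exact sub_eq_zero.1 this
  FF1 p q r h1 h2 h3 h4 := by
    have := ρ.hFF p q r (p-1) (by omega) h3 h4 h1 (by omega) (by omega)
    rw [if_pos (by omega), if_neg (by omega), sub_zero, Ring.lie_def] at this
    rw [← this]; abel
  FP0 p q j h1 h2 h3 h4 h5 h6 := by
    have := ρ.hFP p q j h1 h2 h3 h4 h5
    rw [if_neg h6, Ring.lie_def] at this
    exact sub_eq_zero.1 this
  FP1 p q h1 h2 h3 := by
    have := ρ.hFP p q p h1 h2 h3 h1 (by omega)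
    rw [if_pos rfl, Ring.lie_def] at this
    rw [← this]; abel
  PP i j h1 h2 h3 h4 := by
    have := ρ.hPP i j h1 h2 h3 h4
    rw [Ring.lie_def] at this
    exact sub_eq_zero.1 this

theorem phi_comm {n : ℕ} {M : Type} [AddCommGroup M] [Module ℂ M] (ρ : SLPRep n M) (μ : ℕ → ℤ)
    (i j : ℕ) (hji : j < i) (hi : i + 1 ≤ n + 1) :
    PhiOp ρ.F ρ.P (wsh (j+1) μ) (i+1) * PhiOp ρ.F ρ.P μ (j+1) =
      PhiOp ρ.F ρ.P (wsh (i+1) μ) (j+1) * PhiOp ρ.F ρ.P μ (i+1) := by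
  obtain ⟨d, rfl⟩ : ∃ d, i = j + 1 + d := ⟨i - (j+1), by omega⟩
  have h := exch (toRel ρ) (fun k => (asum μ k : ℂ)) (fun k => (asum (wsh (j+1) μ) k : ℂ)) j
    (asum μ (j+1+d+1)) (by simp [asum_cast_wsh]) (fun t ht => by simp [asum_cast_wsh, ht]) d
    (j+1+d+1) (by omega) hi
  rw [PhiOp_eq, PhiOp_eq, PhiOp_eq, PhiOp_eq]
  rw [XS_congr ρ.F ρ.P (fun k => (asum (wsh (j+1+d+1) μ) k : ℂ)) (fun k => (asum μ k : ℂ)) _ j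
    (fun t ht => by simp only [asum_cast_wsh]; rw [if_neg (by omega), add_zero])]
  rw [asum_cast_wsh μ j (j+1+d+1), asum_cast_wsh μ (j+1+d) (j+1), if_neg (by omega),
    if_neg (by omega), add_zero, add_zero]
  exact h

end Paper

open Paper in
/-- Theorem 3.16: the operators `φ_i` commute on highest weight vectors:
`φ_i(φ_j(v_μ)) = φ_j(φ_i(v_μ))` (each inner application shifting the weight). -/
theorem stmt_14 (n : ℕ) (M : Type) [AddCommGroup M] [Module ℂ M] [FiniteDimensional ℂ M]
    (ρ : SLPRep n M) (μ : ℕ → ℤ) (hdom : ∀ l, 1 ≤ l → l ≤ n → 0 ≤ μ l)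
    (v : M) (hv : IsHWvec n ρ.H ρ.E μ v)
    (i j : ℕ) (hi : 1 ≤ i) (hi2 : i ≤ n + 1) (hj : 1 ≤ j) (hj2 : j ≤ n + 1) :
    PhiOp ρ.F ρ.P (wsh j μ) i (PhiOp ρ.F ρ.P μ j v) =
      PhiOp ρ.F ρ.P (wsh i μ) j (PhiOp ρ.F ρ.P μ i v) := by
  obtain ⟨i, rfl⟩ : ∃ t, i = t + 1 := ⟨i - 1, by omega⟩
  obtain ⟨j, rfl⟩ : ∃ t, j = t + 1 := ⟨j - 1, by omega⟩
  rcases lt_trichotomy i j with h | h | h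
  · exact (LinearMap.congr_fun (phi_comm ρ μ j i h hj2) v).symm
  · subst h; rfl
  · exact LinearMap.congr_fun (phi_comm ρ μ i j h hi2) v
end

section
/- Let V be a module over sl(n+1) ⋉ C^{n+1} and v_μ a highest weight vector of dominant integral weight μ. Then for each i, P_i v_μ can be recovered from the highest weight vectors φ_k(v_μ) via P_i v_μ = (−1)^{i+1} φ̂_i(v_μ) + Σ_{k=1}^{i−1} (−1)^{k+1} Q̂_k^{(μ(i−1),k)} φ̂_k(v_μ), where φ̂_i(v_μ) = φ_i(v_μ) / ∏_{k=1}^{i−1} |μ_{k,i−1}|. -/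
open Module

namespace Paper

/-- `F̂_{j,k}^{(μ,i)} = F_{j,k} / |μ_{i,k}|` (Definition 3.19). -/
noncomputable def Fhat {A : Type} [Ring A] [Algebra ℂ A]
    (F : ℕ → ℕ → A) (μ : ℕ → ℤ) (i j k : ℕ) : A :=
  (((|mus μ i k| : ℤ) : ℂ))⁻¹ • F j k

/-- `Q̂_k^{(μ(s),i)}` (Definition 3.20): `Q̂_{s+1} = 1`,
`Q̂_k = ∑_{l=k+1}^{s+1} Q̂_l F̂_{k,l-1}^{(μ,i)}`. -/
noncomputable def Qhat {A : Type} [Ring A] [Algebra ℂ A]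
    (F : ℕ → ℕ → A) (μ : ℕ → ℤ) (s i k : ℕ) : A :=
  if s + 1 ≤ k then 1
  else ∑ l ∈ (Finset.Icc (k + 1) (s + 1)).attach,
    Qhat F μ s i l.1 * Fhat F μ i k (l.1 - 1)
termination_by s + 1 - k
decreasing_by
  have := l.2; simp only [Finset.mem_Icc] at this; omega

/-- `φ̂_i(v) = φ_i(v) / ∏_{k=1}^{i-1}|μ_{k,i-1}|`. -/
noncomputable def phihat {M : Type} [AddCommGroup M] [Module ℂ M]
    (F : ℕ → ℕ → Module.End ℂ M) (P : ℕ → Module.End ℂ M)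
    (μ : ℕ → ℤ) (k : ℕ) (v : M) : M :=
  ((((∏ t ∈ Finset.Icc 1 (k - 1), |mus μ t (k - 1)| : ℤ)) : ℂ))⁻¹ • PhiOp F P μ k v

end Paper

namespace Paper

lemma key15 {A : Type} [Ring A] [Algebra ℂ A] (S : Finset ℕ) (z : ℕ → ℂ)
    (N G D : ℕ → ℕ → A)
    (hz : ∀ i ∈ S, ∀ k ∈ S, k < i → z i - z k ≠ 0)
    (hN : ∀ i k, i ≤ k → N i k = 0)
    (hG : ∀ i k, i < k → G i k = 0) (hG1 : ∀ i ∈ S, G i i = 1)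
    (hD : ∀ i k, i < k → D i k = 0) (hD1 : ∀ i ∈ S, D i i = 1)
    (hGr : ∀ i ∈ S, ∀ k ∈ S, (z k - z i) • G i k = ∑ m ∈ S, G i m * N m k)
    (hDr : ∀ i ∈ S, ∀ k ∈ S, (z i - z k) • D i k = ∑ m ∈ S, N i m * D m k)
    (i j : ℕ) (hi : i ∈ S) (hj : j ∈ S) :
    ∑ m ∈ S, D i m * G m j = if i = j then 1 else 0 := by
  have hlt : ∀ i j, i < j → ∑ m ∈ S, D i m * G m j = 0 := by
    intro i j h
    refine Finset.sum_eq_zero fun m _ => ?_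
    rcases lt_or_ge i m with h1 | h1
    · rw [hD _ _ h1, zero_mul]
    · rw [hG m j (by omega), mul_zero]
  have heq : ∀ i ∈ S, ∑ m ∈ S, D i m * G m i = 1 := by
    intro i hi
    rw [Finset.sum_eq_single_of_mem i hi, hD1 i hi, hG1 i hi, one_mul]
    intro m _ hm
    rcases lt_or_gt_of_ne hm with h1 | h1
    · rw [hG _ _ h1, mul_zero]
    · rw [hD _ _ h1, zero_mul]
  have comm : ∀ i ∈ S, ∀ j ∈ S, (z i - z j) • ∑ m ∈ S, D i m * G m j
      = ∑ p ∈ S, N i p * (∑ m ∈ S, D p m * G m j)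
        - ∑ p ∈ S, (∑ m ∈ S, D i m * G m p) * N p j := by
    intro i hi j hj
    have e1 : ∑ p ∈ S, N i p * (∑ m ∈ S, D p m * G m j)
        = ∑ m ∈ S, ((z i - z m) • D i m) * G m j := by
      simp_rw [Finset.mul_sum]
      rw [Finset.sum_comm]
      refine Finset.sum_congr rfl fun m hm => ?_
      rw [hDr i hi m hm, Finset.sum_mul]
      simp_rw [mul_assoc]
    have e2 : ∑ p ∈ S, (∑ m ∈ S, D i m * G m p) * N p j
        = ∑ m ∈ S, D i m * ((z j - z m) • G m j) := by
      simp_rw [Finset.sum_mul]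
      rw [Finset.sum_comm]
      refine Finset.sum_congr rfl fun m hm => ?_
      rw [hGr m hm j hj, Finset.mul_sum]
      simp_rw [mul_assoc]
    rw [e1, e2, ← Finset.sum_sub_distrib, Finset.smul_sum]
    refine Finset.sum_congr rfl fun m hm => ?_
    rw [smul_mul_assoc, mul_smul_comm, ← sub_smul]
    congr 1
    ring
  have main : ∀ d, ∀ i ∈ S, ∀ j ∈ S, i = j + d + 1 → ∑ m ∈ S, D i m * G m j = 0 := by
    intro d
    induction d using Nat.strong_induction_on with
    | _ d ih =>
      intro i hi j hj hij
      have h := comm i hi j hj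
      have s1 : ∑ p ∈ S, N i p * (∑ m ∈ S, D p m * G m j) = N i j := by
        rw [Finset.sum_eq_single_of_mem j hj, heq j hj, mul_one]
        intro p hp hpj
        rcases lt_or_gt_of_ne hpj with h1 | h1
        · rw [hlt _ _ h1, mul_zero]
        · rcases lt_or_ge p i with h2 | h2
          · rw [ih (p - j - 1) (by omega) p hp j hj (by omega), mul_zero]
          · rw [hN _ _ h2, zero_mul]
      have s2 : ∑ p ∈ S, (∑ m ∈ S, D i m * G m p) * N p j = N i j := by
        rw [Finset.sum_eq_single_of_mem i hi, heq i hi, one_mul]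
        intro p hp hpi
        rcases lt_or_gt_of_ne hpi with h1 | h1
        · rcases lt_or_ge j p with h2 | h2
          · rw [ih (i - p - 1) (by omega) i hi p hp (by omega), zero_mul]
          · rw [hN _ _ h2, mul_zero]
        · rw [hlt _ _ h1, zero_mul]
      rw [s1, s2, sub_self] at h
      exact (smul_eq_zero_iff_right (hz i hi j hj (by omega))).1 h
  rcases lt_trichotomy i j with h | h | h
  · rw [hlt _ _ h, if_neg (by omega)]
  · subst h; rw [heq i hi, if_pos rfl]
  · rw [main (i - j - 1) i hi j hj (by omega), if_neg (by omega)]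

lemma mus_split (μ : ℕ → ℤ) (k s : ℕ) (h1 : 1 ≤ k) (h : k ≤ s + 1) :
    mus μ k s = (∑ l ∈ Finset.Ico 1 k, (μ l + 1)) - ∑ l ∈ Finset.Ico 1 (s + 1), (μ l + 1) := by
  have := Finset.sum_Ico_consecutive (fun l => μ l + 1) h1 h
  have e : Finset.Icc k s = Finset.Ico k (s + 1) := by ext; simp
  rw [mus, e]
  linarith

lemma mus_neg (n : ℕ) (μ : ℕ → ℤ) (hdom : ∀ l, 1 ≤ l → l ≤ n → 0 ≤ μ l) (k s : ℕ)
    (h1 : 1 ≤ k) (h2 : k ≤ s) (h3 : s ≤ n) : mus μ k s < 0 := by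
  rw [mus, neg_lt_zero]
  refine Finset.sum_pos (fun l hl => ?_) ⟨k, by simp [h2]⟩
  rw [Finset.mem_Icc] at hl
  have := hdom l (by omega) (by omega)
  omega

section
variable {A : Type} [Ring A] [Algebra ℂ A]

lemma Qhat_top (F : ℕ → ℕ → A) (μ : ℕ → ℤ) (s i k : ℕ) (h : s + 1 ≤ k) :
    Qhat F μ s i k = 1 := by
  rw [Qhat, if_pos h]

lemma Qhat_rec (F : ℕ → ℕ → A) (μ : ℕ → ℤ) (s i k : ℕ) (h : k < s + 1) :
    Qhat F μ s i k = ∑ l ∈ Finset.Icc (k + 1) (s + 1),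
      Qhat F μ s i l * Fhat F μ i k (l - 1) := by
  rw [Qhat, if_neg (by omega)]
  exact Finset.sum_attach (Finset.Icc (k + 1) (s + 1))
    (fun l => Qhat F μ s i l * Fhat F μ i k (l - 1))

lemma Qop_top (F : ℕ → ℕ → A) (μ : ℕ → ℤ) (s k : ℕ) (h : s + 1 ≤ k) :
    Qop F μ s k = 1 := by
  rw [Qop, if_pos h]

lemma Qop_rec (F : ℕ → ℕ → A) (μ : ℕ → ℤ) (s k : ℕ) (h : k < s + 1) :
    Qop F μ s k = ∑ m ∈ Finset.Icc (k + 1) (s + 1),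
      Qop F μ s m * Fm F μ s k (m - 1) := by
  rw [Qop, if_neg (by omega)]
  rw [Finset.sum_attach (Finset.range (s + 1 - k))
    (fun l => Qop F μ s (s - l + 1) * Fm F μ s k (s - l))]
  refine Finset.sum_nbij' (fun l => s - l + 1) (fun m => s + 1 - m) ?_ ?_ ?_ ?_ ?_
  · intro l hl; simp at *; omega
  · intro l hl; simp at *; omega
  · intro l hl; simp at *; omega
  · intro l hl; simp at *; omega
  · intro l hl; simp

/-- Left expansion of `Qhat`. -/
lemma Qhat_left (F : ℕ → ℕ → A) (μ : ℕ → ℤ) (k i : ℕ) :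
    ∀ d l, l + d + 1 = i → Qhat F μ (i - 1) k l =
      Fhat F μ k l (i - 1) + ∑ p ∈ Finset.Ico (l + 1) i,
        Fhat F μ k p (i - 1) * Qhat F μ (p - 1) k l := by
  intro d
  induction d using Nat.strong_induction_on with
  | _ d ih =>
    intro l hl
    have hs : i - 1 + 1 = i := by omega
    rw [Qhat_rec _ _ _ _ _ (by omega), hs]
    have e : Finset.Icc (l + 1) i = insert i (Finset.Ico (l + 1) i) := by
      ext x; simp; omega
    rw [e, Finset.sum_insert (by simp), Qhat_top _ _ _ _ i (by omega), one_mul]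
    congr 1
    have e1 : ∀ m ∈ Finset.Ico (l + 1) i,
        Qhat F μ (i - 1) k m * Fhat F μ k l (m - 1) =
        ∑ p ∈ Finset.Ico (l + 1) i, if m ≤ p then
          Fhat F μ k p (i - 1) * (Qhat F μ (p - 1) k m * Fhat F μ k l (m - 1)) else 0 := by
      intro m hm
      rw [Finset.mem_Ico] at hm
      rw [ih (i - m - 1) (by omega) m (by omega), ← Finset.sum_filter]
      have e2 : (Finset.Ico (l + 1) i).filter (fun p => m ≤ p)
          = insert m (Finset.Ico (m + 1) i) := by
        ext x; simp; omega
      rw [e2, Finset.sum_insert (by simp), Qhat_top _ _ (m - 1) _ m (by omega), one_mul,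
        add_mul, Finset.sum_mul]
      simp_rw [mul_assoc]
    rw [Finset.sum_congr rfl e1, Finset.sum_comm]
    refine Finset.sum_congr rfl fun p hp => ?_
    rw [Finset.mem_Ico] at hp
    rw [Qhat_rec _ _ (p - 1) _ l (by omega), Finset.mul_sum, ← Finset.sum_filter]
    refine Finset.sum_congr ?_ fun _ _ => rfl
    ext x; simp; omega

/-- normalized `Qop`. -/
noncomputable def G15 (F : ℕ → ℕ → A) (μ : ℕ → ℤ) (i k : ℕ) : A :=
  if k ≤ i then ((∏ t ∈ Finset.Icc k (i - 1), mus μ t (i - 1) : ℤ) : ℂ)⁻¹ • Qop F μ (i - 1) k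
  else 0

noncomputable def D15 (F : ℕ → ℕ → A) (μ : ℕ → ℤ) (i k : ℕ) : A :=
  if k ≤ i then Qhat F μ (i - 1) k k else 0

def N15 (F : ℕ → ℕ → A) (i k : ℕ) : A :=
  if k < i then F k (i - 1) else 0

lemma inv15 (n : ℕ) (F : ℕ → ℕ → A) (μ : ℕ → ℤ) (hdom : ∀ l, 1 ≤ l → l ≤ n → 0 ≤ μ l)
    (i j : ℕ) (hi : i ∈ Finset.Icc 1 (n + 1)) (hj : j ∈ Finset.Icc 1 (n + 1)) :
    ∑ m ∈ Finset.Icc 1 (n + 1), D15 F μ i m * G15 F μ m j = if i = j then 1 else 0 := by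
  have hm : ∀ k i, 1 ≤ k → k < i → 
      ((∑ l ∈ Finset.Ico 1 k, (μ l + 1) : ℤ) : ℂ) - ((∑ l ∈ Finset.Ico 1 i, (μ l + 1) : ℤ) : ℂ)
        = ((mus μ k (i - 1) : ℤ) : ℂ) := by
    intro k i h1 h2
    rw [mus_split μ k (i - 1) h1 (by omega), show i - 1 + 1 = i by omega]
    push_cast
    rfl
  have hne : ∀ k i, 1 ≤ k → k < i → i ≤ n + 1 → ((mus μ k (i - 1) : ℤ) : ℂ) ≠ 0 := by
    intro k i h1 h2 h3
    have := mus_neg n μ hdom k (i - 1) h1 (by omega) (by omega)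
    exact_mod_cast this.ne
  refine key15 (Finset.Icc 1 (n + 1)) (fun k => ((∑ l ∈ Finset.Ico 1 k, (μ l + 1) : ℤ) : ℂ))
    (N15 F) (G15 F μ) (D15 F μ) ?_ ?_ ?_ ?_ ?_ ?_ ?_ ?_ i j hi hj
  · intro i hi k hk hki
    rw [Finset.mem_Icc] at hi hk
    have := hne k i hk.1 hki hi.2
    rw [← hm k i hk.1 hki] at this
    intro h
    apply this
    rw [← neg_sub, h, neg_zero]
  · intro i k h
    rw [N15, if_neg (by omega)]
  · intro i k h
    rw [G15, if_neg (by omega)]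
  · intro i hi
    rw [Finset.mem_Icc] at hi
    rw [G15, if_pos le_rfl, Qop_top _ _ _ _ (by omega), Finset.Icc_eq_empty (by omega)]
    simp
  · intro i k h
    rw [D15, if_neg (by omega)]
  · intro i hi
    rw [Finset.mem_Icc] at hi
    rw [D15, if_pos le_rfl, Qhat_top _ _ _ _ _ (by omega)]
  · intro i hi k hk
    rw [Finset.mem_Icc] at hi hk
    rcases lt_or_ge k i with h | h
    · have e : ∑ m ∈ Finset.Icc 1 (n + 1), G15 F μ i m * N15 F m k
          = ∑ m ∈ Finset.Icc (k + 1) i, G15 F μ i m * N15 F m k := by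
        symm
        refine Finset.sum_subset ?_ ?_
        · intro x; simp; omega
        · intro x hx hx2
          simp only [Finset.mem_Icc, not_and, not_le] at hx hx2
          rcases lt_or_ge k x with h1 | h1
          · rw [G15, if_neg (by have := hx2 h1; omega), zero_mul]
          · rw [N15, if_neg (by omega), mul_zero]
      rw [e]
      rw [hm k i hk.1 h, G15, if_pos h.le, Qop_rec _ _ _ _ (by omega),
        show i - 1 + 1 = i by omega, Finset.smul_sum, Finset.smul_sum]
      refine Finset.sum_congr rfl fun m hm' => ?_
      rw [Finset.mem_Icc] at hm'
      rw [G15, if_pos hm'.2, N15, if_pos (by omega), Fm, mul_smul_comm, smul_mul_assoc,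
        smul_smul, smul_smul]
      congr 1
      have c1 : Finset.Icc k (i - 1)
          = insert k (Finset.Icc (k + 1) (m - 1) ∪ Finset.Icc m (i - 1)) := by
        ext x; simp; omega
      have c2 : Disjoint (Finset.Icc (k + 1) (m - 1)) (Finset.Icc m (i - 1)) := by
        rw [Finset.disjoint_left]; intro x; simp; omega
      rw [c1, Finset.prod_insert (by simp; omega), Finset.prod_union c2]
      have n1 := hne k i hk.1 h hi.2
      have n2 : ((∏ t ∈ Finset.Icc (k + 1) (m - 1), mus μ t (i - 1) : ℤ) : ℂ) ≠ 0 := by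
        rw [Int.cast_prod, Finset.prod_ne_zero_iff]
        intro t ht
        rw [Finset.mem_Icc] at ht
        exact hne t i (by omega) (by omega) hi.2
      have n3 : ((∏ t ∈ Finset.Icc m (i - 1), mus μ t (i - 1) : ℤ) : ℂ) ≠ 0 := by
        rw [Int.cast_prod, Finset.prod_ne_zero_iff]
        intro t ht
        rw [Finset.mem_Icc] at ht
        exact hne t i (by omega) (by omega) hi.2
      rw [Int.cast_mul, Int.cast_mul]
      field_simp
    · have e : ∑ m ∈ Finset.Icc 1 (n + 1), G15 F μ i m * N15 F m k = 0 := by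
        refine Finset.sum_eq_zero fun x _ => ?_
        rcases lt_or_ge k x with h1 | h1
        · rw [G15, if_neg (by omega), zero_mul]
        · rw [N15, if_neg (by omega), mul_zero]
      rw [e]
      rcases h.eq_or_lt with h | h
      · subst h; simp
      · rw [G15, if_neg (by omega), smul_zero]
  · intro i hi k hk
    rw [Finset.mem_Icc] at hi hk
    rcases lt_or_ge k i with h | h
    · have e : ∑ m ∈ Finset.Icc 1 (n + 1), N15 F i m * D15 F μ m k
          = ∑ m ∈ insert k (Finset.Ico (k + 1) i), N15 F i m * D15 F μ m k := by
        symm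
        refine Finset.sum_subset ?_ ?_
        · intro x; simp; omega
        · intro x hx hx2
          simp only [Finset.mem_Icc, Finset.mem_insert, Finset.mem_Ico] at hx hx2
          rcases lt_or_ge x k with h1 | h1
          · rw [D15, if_neg (by omega), mul_zero]
          · rw [N15, if_neg (by omega), zero_mul]
      have n1 := hne k i hk.1 h hi.2
      have habs : ((|mus μ k (i - 1)| : ℤ) : ℂ) = -((mus μ k (i - 1) : ℤ) : ℂ) := by
        rw [abs_of_neg (mus_neg n μ hdom k (i - 1) hk.1 (by omega) (by omega)), Int.cast_neg]
      have hF : ∀ p, (-((mus μ k (i - 1) : ℤ) : ℂ)) • Fhat F μ k p (i - 1) = F p (i - 1) := by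
        intro p
        rw [Fhat, habs, smul_smul, mul_inv_cancel₀ (neg_ne_zero.2 n1), one_smul]
      rw [e]
      rw [← neg_sub, hm k i hk.1 h, Finset.sum_insert (by simp), D15, if_pos h.le, D15,
        if_pos le_rfl, N15, if_pos h, Qhat_top _ _ (k - 1) _ _ (by omega), mul_one,
        Qhat_left F μ k i (i - k - 1) k (by omega), smul_add, hF, Finset.smul_sum]
      congr 1
      refine Finset.sum_congr rfl fun p hp => ?_
      rw [Finset.mem_Ico] at hp
      rw [← smul_mul_assoc, hF, N15, if_pos hp.2, D15, if_pos (by omega)]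
    · have e : ∑ m ∈ Finset.Icc 1 (n + 1), N15 F i m * D15 F μ m k = 0 := by
        refine Finset.sum_eq_zero fun x _ => ?_
        rcases lt_or_ge x k with h1 | h1
        · rw [D15, if_neg (by omega), mul_zero]
        · rw [N15, if_neg (by omega), zero_mul]
      rw [e]
      rcases h.eq_or_lt with h | h
      · subst h; simp
      · rw [D15, if_neg (by omega), smul_zero]

end

lemma psi15 {M : Type} [AddCommGroup M] [Module ℂ M] (n : ℕ)
    (F : ℕ → ℕ → Module.End ℂ M) (P : ℕ → Module.End ℂ M)
    (μ : ℕ → ℤ) (hdom : ∀ l, 1 ≤ l → l ≤ n → 0 ≤ μ l) (v : M)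
    (k : ℕ) (hk : k ∈ Finset.Icc 1 (n + 1)) :
    (-1 : ℂ) ^ (k + 1) • phihat F P μ k v
      = ∑ j ∈ Finset.Icc 1 (n + 1), G15 F μ k j (P j v) := by
  rw [Finset.mem_Icc] at hk
  have hneg : ∀ t ∈ Finset.Icc 1 (k - 1), mus μ t (k - 1) < 0 := by
    intro t ht
    rw [Finset.mem_Icc] at ht
    exact mus_neg n μ hdom t (k - 1) ht.1 (by omega) (by omega)
  have hprod : (-1 : ℂ) ^ (k + 1) * ((∏ t ∈ Finset.Icc 1 (k - 1), |mus μ t (k - 1)| : ℤ) : ℂ)⁻¹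
      = ((∏ t ∈ Finset.Icc 1 (k - 1), mus μ t (k - 1) : ℤ) : ℂ)⁻¹ := by
    have : (∏ t ∈ Finset.Icc 1 (k - 1), |mus μ t (k - 1)| : ℤ)
        = (-1) ^ (k - 1) * ∏ t ∈ Finset.Icc 1 (k - 1), mus μ t (k - 1) := by
      rw [Finset.prod_congr rfl (fun t ht => abs_of_neg (hneg t ht)), Finset.prod_neg]
      simp
    rw [this, Int.cast_mul, mul_inv, ← mul_assoc]
    obtain ⟨q, rfl⟩ : ∃ q, k = q + 1 := ⟨k - 1, by omega⟩
    rw [show q + 1 + 1 = q + 2 from rfl, show q + 1 - 1 = q from rfl, pow_add]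
    push_cast
    rcases neg_one_pow_eq_or ℂ q with h | h <;> rw [h] <;> simp
  have hphi : PhiOp F P μ k = ∑ j ∈ Finset.Icc 1 k, Qop F μ (k - 1) j * Pm P μ k j := by
    have e : Finset.Icc 1 k = insert k (Finset.Icc 1 (k - 1)) := by ext x; simp; omega
    rw [e, Finset.sum_insert (by simp; omega), Qop_top _ _ _ _ (by omega), one_mul]
    rfl
  have e : ∑ j ∈ Finset.Icc 1 (n + 1), G15 F μ k j (P j v)
      = ∑ j ∈ Finset.Icc 1 k, G15 F μ k j (P j v) := by
    symm
    refine Finset.sum_subset ?_ ?_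
    · intro x; simp; omega
    · intro x hx hx2
      simp only [Finset.mem_Icc, not_and, not_le] at hx hx2
      rw [G15, if_neg (by have := hx2 hx.1; omega), LinearMap.zero_apply]
  rw [phihat, smul_smul, hprod, hphi, e, LinearMap.sum_apply, Finset.smul_sum]
  refine Finset.sum_congr rfl fun j hj => ?_
  rw [Finset.mem_Icc] at hj
  rw [G15, if_pos hj.2, Pm, mul_smul_comm, LinearMap.smul_apply, LinearMap.smul_apply,
    Module.End.mul_apply, smul_smul]
  congr 1
  have c1 : Finset.Icc 1 (k - 1) = Finset.Icc 1 (j - 1) ∪ Finset.Icc j (k - 1) := by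
    ext x; simp; omega
  have c2 : Disjoint (Finset.Icc 1 (j - 1)) (Finset.Icc j (k - 1)) := by
    rw [Finset.disjoint_left]; intro x; simp; omega
  have n2 : ((∏ t ∈ Finset.Icc 1 (j - 1), mus μ t (k - 1) : ℤ) : ℂ) ≠ 0 := by
    rw [Int.cast_prod, Finset.prod_ne_zero_iff]
    intro t ht
    rw [Finset.mem_Icc] at ht
    exact_mod_cast (hneg t (by rw [Finset.mem_Icc]; omega)).ne
  rw [c1, Finset.prod_union c2, Int.cast_mul, mul_inv, mul_comm, ← mul_assoc,
    mul_inv_cancel₀ n2, one_mul]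

end Paper

open Paper in
/-- Proposition 3.21: the inversion formula
`P_i v_μ = (-1)^{i+1} φ̂_i(v_μ) + ∑_{k=1}^{i-1} (-1)^{k+1} Q̂_k^{(μ(i-1),k)} φ̂_k(v_μ)`. -/
theorem stmt_15 (n : ℕ) (M : Type) [AddCommGroup M] [Module ℂ M]
    (ρ : SLPRep n M) (μ : ℕ → ℤ) (hdom : ∀ l, 1 ≤ l → l ≤ n → 0 ≤ μ l)
    (v : M) (hv : IsHWvec n ρ.H ρ.E μ v)
    (i : ℕ) (hi : 1 ≤ i) (hi2 : i ≤ n + 1) :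
    ρ.P i v =
      (-1 : ℂ) ^ (i + 1) • phihat ρ.F ρ.P μ i v +
        ∑ k ∈ Finset.Icc 1 (i - 1), (-1 : ℂ) ^ (k + 1) •
          (Qhat ρ.F μ (i - 1) k k) (phihat ρ.F ρ.P μ k v) := by
  have hiS : i ∈ Finset.Icc 1 (n + 1) := Finset.mem_Icc.2 ⟨hi, hi2⟩
  have h1 : (-1 : ℂ) ^ (i + 1) • phihat ρ.F ρ.P μ i v +
        ∑ k ∈ Finset.Icc 1 (i - 1), (-1 : ℂ) ^ (k + 1) •
          (Qhat ρ.F μ (i - 1) k k) (phihat ρ.F ρ.P μ k v)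
      = ∑ k ∈ Finset.Icc 1 (n + 1), D15 ρ.F μ i k ((-1 : ℂ) ^ (k + 1) • phihat ρ.F ρ.P μ k v) := by
    have e : ∑ k ∈ Finset.Icc 1 (n + 1), D15 ρ.F μ i k ((-1 : ℂ) ^ (k + 1) • phihat ρ.F ρ.P μ k v)
        = ∑ k ∈ insert i (Finset.Icc 1 (i - 1)),
          D15 ρ.F μ i k ((-1 : ℂ) ^ (k + 1) • phihat ρ.F ρ.P μ k v) := by
      symm
      refine Finset.sum_subset ?_ ?_
      · intro x; simp; omega
      · intro x hx hx2
        simp only [Finset.mem_Icc, Finset.mem_insert] at hx hx2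
        rw [D15, if_neg (by omega), LinearMap.zero_apply]
    rw [e, Finset.sum_insert (by simp; omega), D15, if_pos le_rfl,
      Qhat_top _ _ _ _ _ (by omega), Module.End.one_apply]
    congr 1
    refine Finset.sum_congr rfl fun k hk => ?_
    rw [Finset.mem_Icc] at hk
    rw [D15, if_pos (by omega), map_smul]
  rw [h1, Finset.sum_congr rfl fun k hk => by rw [psi15 n ρ.F ρ.P μ hdom v k hk, map_sum],
    Finset.sum_comm]
  have h2 : ∀ j ∈ Finset.Icc 1 (n + 1), ∑ k ∈ Finset.Icc 1 (n + 1),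
      D15 ρ.F μ i k (G15 ρ.F μ k j (ρ.P j v)) = if i = j then ρ.P j v else 0 := by
    intro j hj
    have := congrArg (fun T : Module.End ℂ M => T (ρ.P j v)) (inv15 n ρ.F μ hdom i j hiS hj)
    simp only [LinearMap.sum_apply, Module.End.mul_apply] at this
    rw [this]
    split_ifs <;> simp
  rw [Finset.sum_congr rfl h2, Finset.sum_ite_eq, if_pos hiS]
end

section
/- Let V be a cyclic sl(n+1) ⋉ C^{n+1}-module generated by a highest weight vector v_μ of weight μ, and let J_k^μ(i_1,...,i_{k−1}) be the minimal positive integer with φ_k^{J}(φ_{k−1}^{i_{k−1}}(···(φ_1^{i_1}(v_μ))···)) = 0. Then: (a) J_1^μ ≥ 1; (b) the set of all these integers is bounded; (c) J_k^μ is weakly decreasing in each argument: J_k^μ(i_1,...,i_{k−1}) ≤ J_k^μ(j_1,...,j_{k−1}) whenever j_l ≤ i_l for all l; (d) 1 ≤ J_k^μ(i_1,...,i_{k−1}) ≤ μ_{k−1} + 1 for 2 ≤ k ≤ n+1. -/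
open Module

namespace Paper

variable {M : Type} [AddCommGroup M] [Module ℂ M]

/-- `φ_{k-1}^{i_{k-1}}(⋯(φ_1^{i_1}(v))⋯)`. -/
noncomputable def vIter (F : ℕ → ℕ → Module.End ℂ M) (P : ℕ → Module.End ℂ M)
    (μ : ℕ → ℤ) (v : M) (k : ℕ) (iv : ℕ → ℕ) : M :=
  phiList F P (evec k iv) μ v

/-- `φ_k^{J}(φ_{k-1}^{i_{k-1}}(⋯(φ_1^{i_1}(v))⋯))`. -/
noncomputable def vIterJ (F : ℕ → ℕ → Module.End ℂ M) (P : ℕ → Module.End ℂ M)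
    (μ : ℕ → ℤ) (v : M) (k : ℕ) (iv : ℕ → ℕ) (J : ℕ) : M :=
  phiList F P (evec k iv ++ List.replicate J k) μ v

/-- `J` is the minimal positive integer with `φ_k^J(φ_{k-1}^{i_{k-1}}(⋯)) = 0`
(Definition 3.23). -/
def Jmin (F : ℕ → ℕ → Module.End ℂ M) (P : ℕ → Module.End ℂ M)
    (μ : ℕ → ℤ) (v : M) (k : ℕ) (iv : ℕ → ℕ) (J : ℕ) : Prop :=
  0 < J ∧ vIterJ F P μ v k iv J = 0 ∧
    ∀ J', 0 < J' → J' < J → vIterJ F P μ v k iv J' ≠ 0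

end Paper

namespace Pf
open Paper

section Ringy
variable {A : Type} [Ring A] [Algebra ℂ A]

/-- The truncated lowering operators, by levels. -/
noncomputable def G (F : ℕ → ℕ → A) (P : ℕ → A) (l : ℕ → ℂ) (t : ℂ) : ℕ → ℕ → A
  | 0, b => P b
  | r + 1, b => (t - l (r + 1)) • G F P l t r b + F (r + 1) (b - 1) * G F P l t r (r + 1)

lemma swap3 {x y : A} (h : x * y = y * x) (z : A) : x * (y * z) = y * (x * z) := by
  rw [← mul_assoc, h, mul_assoc]

lemma swap3' {x y w : A} (h : x * y = y * x - w) (z : A) :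
    x * (y * z) = y * (x * z) - w * z := by
  rw [← mul_assoc, h, sub_mul, mul_assoc]

lemma diff_formula (Ya Yp Xb Xp ea eb Yb Xa : A) (σ τ : ℂ)
    (h1 : Ya * eb = eb * Ya) (h2 : Xb * ea = ea * Xb) (h3 : Yp * eb = eb * Yp - Yb)
    (h4 : Xp * ea = ea * Xp - Xa) :
    (σ • Ya + ea * Yp) * (τ • Xb + eb * Xp) =
      (σ * τ) • (Ya * Xb) + σ • (eb * (Ya * Xp)) + τ • (ea * (Yp * Xb))
        + ea * (eb * (Yp * Xp)) - ea * (Yb * Xp) := by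
  simp only [mul_add, add_mul, smul_mul_assoc, mul_smul_comm, mul_assoc, swap3 h1, swap3' h3,
    mul_sub, smul_smul]
  module

lemma rtt_step (Ya Yb Yp Xa Xb Xp ea eb : A) (σ τ : ℂ)
    (hee : ea * eb = eb * ea)
    (ya : Ya * eb = eb * Ya) (yb : Yb * ea = ea * Yb) (xa : Xa * eb = eb * Xa)
    (xb : Xb * ea = ea * Xb)
    (ypa : Yp * ea = ea * Yp - Ya) (ypb : Yp * eb = eb * Yp - Yb)
    (xpa : Xp * ea = ea * Xp - Xa) (xpb : Xp * eb = eb * Xp - Xb)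
    (r1 : (τ - σ) • (Ya * Xb - Xb * Ya) = Yb * Xa - Xb * Ya)
    (r2 : (τ - σ) • (Ya * Xp - Xp * Ya) = Yp * Xa - Xp * Ya)
    (r3 : (τ - σ) • (Yp * Xb - Xb * Yp) = Yb * Xp - Xb * Yp)
    (r4 : (τ - σ) • (Yp * Xa - Xa * Yp) = Ya * Xp - Xa * Yp)
    (r5 : Yp * Xp = Xp * Yp) :
    (τ - σ) • ((σ • Ya + ea * Yp) * (τ • Xb + eb * Xp)
      - (τ • Xb + eb * Xp) * (σ • Ya + ea * Yp)) =
      (σ • Yb + eb * Yp) * (τ • Xa + ea * Xp) - (τ • Xb + eb * Xp) * (σ • Ya + ea * Yp) := by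
  rw [diff_formula Ya Yp Xb Xp ea eb Yb Xa σ τ ya xb ypb xpa,
    diff_formula Xb Xp Ya Yp eb ea Xa Yb τ σ xb ya xpa ypb,
    diff_formula Yb Yp Xa Xp eb ea Ya Xb σ τ yb xa ypa xpb, r5, swap3 hee]
  have k2 := congrArg (eb * ·) r2
  have k3 := congrArg (ea * ·) r3
  have k4 := congrArg (eb * ·) r4
  simp only [mul_sub, mul_smul_comm, smul_sub] at r1 k2 k3 k4 ⊢
  linear_combination (norm := module) (σ * τ) • r1 + σ • k2 + τ • k3 - k4

lemma sym_step (Ya Yb Yp Xa Xb Xp ea eb : A) (σ τ : ℂ)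
    (hee : ea * eb = eb * ea)
    (ya : Ya * eb = eb * Ya) (yb : Yb * ea = ea * Yb) (xa : Xa * eb = eb * Xa)
    (xb : Xb * ea = ea * Xb)
    (ypa : Yp * ea = ea * Yp - Ya) (ypb : Yp * eb = eb * Yp - Yb)
    (xpa : Xp * ea = ea * Xp - Xa) (xpb : Xp * eb = eb * Xp - Xb)
    (r3 : (τ - σ) • (Yp * Xb - Xb * Yp) = Yb * Xp - Xb * Yp)
    (r4 : (τ - σ) • (Yp * Xa - Xa * Yp) = Ya * Xp - Xa * Yp)
    (r5 : Yp * Xp = Xp * Yp)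
    (s1 : (Ya * Xb - Xb * Ya) + (Yb * Xa - Xa * Yb) = 0)
    (s2 : (Ya * Xp - Xp * Ya) + (Yp * Xa - Xa * Yp) = 0)
    (s3 : (Yb * Xp - Xp * Yb) + (Yp * Xb - Xb * Yp) = 0) :
    ((σ • Ya + ea * Yp) * (τ • Xb + eb * Xp) - (τ • Xb + eb * Xp) * (σ • Ya + ea * Yp)) +
      ((σ • Yb + eb * Yp) * (τ • Xa + ea * Xp) - (τ • Xa + ea * Xp) * (σ • Yb + eb * Yp)) = 0 := by
  rw [diff_formula Ya Yp Xb Xp ea eb Yb Xa σ τ ya xb ypb xpa,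
    diff_formula Xb Xp Ya Yp eb ea Xa Yb τ σ xb ya xpa ypb,
    diff_formula Yb Yp Xa Xp eb ea Ya Xb σ τ yb xa ypa xpb,
    diff_formula Xa Xp Yb Yp ea eb Xb Ya τ σ xa yb xpb ypa, r5, swap3 hee]
  have k2 := congrArg (eb * ·) s2
  have k3 := congrArg (ea * ·) s3
  have k4 := congrArg (eb * ·) r4
  have k5 := congrArg (ea * ·) r3
  simp only [mul_sub, mul_add, mul_smul_comm, smul_sub, mul_zero] at k2 k3 k4 k5 ⊢
  linear_combination (norm := module) (σ * τ) • s1 + σ • k2 + σ • k3 + k4 + k5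

variable (n : ℕ) (F : ℕ → ℕ → A) (P : ℕ → A)

structure Rel : Prop where
  ff0 : ∀ p a r b, 1 ≤ p → p < a → a ≤ n + 1 → 1 ≤ r → r < b → b ≤ n + 1 →
    r ≤ p → p ≠ b → F p (a - 1) * F r (b - 1) = F r (b - 1) * F p (a - 1)
  ff1 : ∀ p a r, 1 ≤ r → r < p → p < a → a ≤ n + 1 →
    F p (a - 1) * F r (p - 1) = F r (p - 1) * F p (a - 1) + F r (a - 1)
  fp0 : ∀ p a b, 1 ≤ p → p < a → a ≤ n + 1 → 1 ≤ b → b ≤ n + 1 → p ≠ b →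
    F p (a - 1) * P b = P b * F p (a - 1)
  fp1 : ∀ p a, 1 ≤ p → p < a → a ≤ n + 1 → F p (a - 1) * P p = P p * F p (a - 1) + P a
  pp : ∀ a b, 1 ≤ a → a ≤ n + 1 → 1 ≤ b → b ≤ n + 1 → P a * P b = P b * P a

variable {n F P}

lemma vec (h : Rel n F P) (l : ℕ → ℂ) (t : ℂ) (r : ℕ) : ∀ p a b, r < p → p < a → a ≤ n + 1 →
    r < b → b ≤ n + 1 → 
    F p (a - 1) * G F P l t r b = G F P l t r b * F p (a - 1) + if p = b then G F P l t r a else 0 := by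
  induction r with
  | zero =>
    intro p a b h1 h2 h3 h4 h5
    simp only [G]
    split_ifs with hb
    · subst hb; exact h.fp1 _ _ h1 h2 h3
    · rw [add_zero]; exact h.fp0 _ _ _ h1 h2 h3 h4 h5 hb
  | succ r ih =>
    intro p a b h1 h2 h3 h4 h5
    have e1 := ih p a b (by omega) h2 h3 (by omega) h5
    have e2 := ih p a (r+1) (by omega) h2 h3 (by omega) (by omega)
    rw [if_neg (by omega), add_zero] at e2
    simp only [G]
    split_ifs with hb
    · subst hb
      rw [if_pos rfl] at e1
      have e3 := h.ff1 p a (r+1) (by omega) h1 h2 h3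
      rw [mul_add, mul_smul_comm, e1, ← mul_assoc, e3, add_mul, mul_assoc, e2, add_mul,
        smul_mul_assoc, mul_assoc]
      module
    · rw [if_neg hb, add_zero] at e1
      have e3 := h.ff0 p a (r+1) b (by omega) h2 h3 (by omega) h4 h5 (by omega) hb
      rw [mul_add, mul_smul_comm, e1, ← mul_assoc, e3, mul_assoc, e2, add_mul,
        smul_mul_assoc, mul_assoc]
      module

lemma vec0 (h : Rel n F P) (l : ℕ → ℂ) (t : ℂ) (r p a b : ℕ) (h1 : r < p) (h2 : p < a)
    (h3 : a ≤ n + 1) (h4 : r < b) (h5 : b ≤ n + 1) (h6 : p ≠ b) :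
    G F P l t r b * F p (a - 1) = F p (a - 1) * G F P l t r b := by
  rw [vec h l t r p a b h1 h2 h3 h4 h5, if_neg h6, add_zero]

lemma vec1 (h : Rel n F P) (l : ℕ → ℂ) (t : ℂ) (r p a : ℕ) (h1 : r < p) (h2 : p < a)
    (h3 : a ≤ n + 1) :
    G F P l t r p * F p (a - 1) = F p (a - 1) * G F P l t r p - G F P l t r a := by
  rw [vec h l t r p a p h1 h2 h3 (by omega) (by omega), if_pos rfl]; abel

lemma rtt (h : Rel n F P) (l : ℕ → ℂ) (s t : ℂ) (r : ℕ) : ∀ a b, r < a → a ≤ n + 1 →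
    r < b → b ≤ n + 1 → 
    (t - s) • (G F P l s r a * G F P l t r b - G F P l t r b * G F P l s r a) =
      G F P l s r b * G F P l t r a - G F P l t r b * G F P l s r a ∧
    (G F P l s r a * G F P l t r b - G F P l t r b * G F P l s r a) + 
    (G F P l s r b * G F P l t r a - G F P l t r a * G F P l s r b) = 0 := by
  induction r with
  | zero =>
    intro a b h1 h2 h3 h4
    simp only [G]
    rw [h.pp a b h1 h2 h3 h4]
    simp
  | succ r ih =>
    intro a b h1 h2 h3 h4
    have hp : G F P l s r (r+1) * G F P l t r (r+1) = G F P l t r (r+1) * G F P l s r (r+1) := by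
      have := (ih (r+1) (r+1) (by omega) (by omega) (by omega) (by omega)).2
      rw [← two_smul ℂ, smul_eq_zero] at this
      exact sub_eq_zero.1 (this.resolve_left (by norm_num))
    have hts : t - s = (t - l (r+1)) - (s - l (r+1)) := by ring
    have hee := h.ff0 (r+1) a (r+1) b (by omega) (by omega) (by omega) (by omega) (by omega)
      (by omega) le_rfl (by omega)
    have ya := vec0 h l s r (r+1) b a (by omega) (by omega) (by omega) (by omega) (by omega) (by omega)
    have yb := vec0 h l s r (r+1) a b (by omega) (by omega) (by omega) (by omega) (by omega) (by omega)
    have xa := vec0 h l t r (r+1) b a (by omega) (by omega) (by omega) (by omega) (by omega) (by omega)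
    have xb := vec0 h l t r (r+1) a b (by omega) (by omega) (by omega) (by omega) (by omega) (by omega)
    have ypa := vec1 h l s r (r+1) a (by omega) (by omega) (by omega)
    have ypb := vec1 h l s r (r+1) b (by omega) (by omega) (by omega)
    have xpa := vec1 h l t r (r+1) a (by omega) (by omega) (by omega)
    have xpb := vec1 h l t r (r+1) b (by omega) (by omega) (by omega)
    have q1 := ih a b (by omega) (by omega) (by omega) (by omega)
    have q2 := ih a (r+1) (by omega) (by omega) (by omega) (by omega)
    have q3 := ih (r+1) b (by omega) (by omega) (by omega) (by omega)
    have q4 := ih (r+1) a (by omega) (by omega) (by omega) (by omega)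
    have q5 := ih b (r+1) (by omega) (by omega) (by omega) (by omega)
    rw [hts] at q1 q2 q3 q4 q5 ⊢
    simp only [G]
    exact ⟨rtt_step _ _ _ _ _ _ _ _ _ _ hee ya yb xa xb ypa ypb xpa xpb q1.1 q2.1 q3.1 q4.1 hp,
      sym_step _ _ _ _ _ _ _ _ _ _ hee ya yb xa xb ypa ypb xpa xpb q3.1 q4.1 hp q1.2 q2.2 q5.2⟩

lemma G_congr (l l' : ℕ → ℂ) (t : ℂ) (r : ℕ) (hl : ∀ m, m ≤ r → l m = l' m) (b : ℕ) :
    G F P l t r b = G F P l' t r b := by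
  induction r generalizing b with
  | zero => rfl
  | succ r ih =>
    simp only [G]
    rw [ih (fun m hm => hl m (by omega)), ih (fun m hm => hl m (by omega)), hl _ le_rfl]

lemma comm_lev (h : Rel n F P) (l : ℕ → ℂ) (t : ℂ) (i : ℕ) (l' : ℕ → ℂ)
    (hl' : l' = fun m => l m + if m = i + 1 then 1 else 0)
    (r : ℕ) (hr : i + 1 ≤ r) : ∀ b, r < b → b ≤ n + 1 →
    G F P l (l (i+1)) i (i+1) * G F P l t r b = G F P l' t r b * G F P l (l (i+1)) i (i+1) := by
  have hc : ∀ b, G F P l' t i b = G F P l t i b := fun b => by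
    apply G_congr; intro m hm; rw [hl']; simp; omega
  induction r, hr using Nat.le_induction with
  | base =>
    intro b h1 h2
    have xb := (rtt h l (l (i+1)) t i (i+1) b (by omega) (by omega) (by omega) (by omega)).1
    have hp : G F P l (l (i+1)) i (i+1) * G F P l t i (i+1) 
        = G F P l t i (i+1) * G F P l (l (i+1)) i (i+1) := by
      have := (rtt h l (l (i+1)) t i (i+1) (i+1) (by omega) (by omega) (by omega) (by omega)).2
      rw [← two_smul ℂ, smul_eq_zero] at this
      exact sub_eq_zero.1 (this.resolve_left (by norm_num))
    have yp := vec1 h l (l (i+1)) i (i+1) b (by omega) (by omega) (by omega)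
    have hli : l' (i+1) = l (i+1) + 1 := by rw [hl']; simp
    simp only [G, hc, hli]
    rw [mul_add, add_mul, mul_smul_comm, smul_mul_assoc, swap3' yp, hp, mul_assoc]
    linear_combination (norm := module) xb
  | succ r hr ih =>
    intro b h1 h2
    have hli : l' (r+1) = l (r+1) := by rw [hl']; simp; omega
    have e1 := vec0 h l (l (i+1)) i (r+1) b (i+1) (by omega) (by omega) (by omega) (by omega)
      (by omega) (by omega)
    have e2 := ih b (by omega) h2
    have e3 := ih (r+1) (by omega) (by omega)
    simp only [G, hli]
    rw [mul_add, add_mul, mul_smul_comm, smul_mul_assoc, swap3 e1, e2, e3, mul_assoc]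

end Ringy

noncomputable def ell (μ : ℕ → ℤ) (m : ℕ) : ℂ := ((-(∑ i ∈ Finset.range m, (μ i + 1)) : ℤ) : ℂ)

lemma mus_eq (μ : ℕ → ℤ) (k s : ℕ) (h : k ≤ s + 1) :
    ((mus μ k s : ℤ) : ℂ) = ell μ (s + 1) - ell μ k := by
  have e : Finset.Icc k s = Finset.Ico k (s + 1) := by ext x; simp only [Finset.mem_Icc, Finset.mem_Ico]; omega
  rw [mus, ell, ell, e, Finset.sum_Ico_eq_sub _ h]
  push_cast; ring

lemma ell_wsh (μ : ℕ → ℤ) (i : ℕ) :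
    ell (wsh (i + 1) μ) = fun m => ell μ m + if m = i + 1 then 1 else 0 := by
  funext m
  unfold ell
  have key : ∑ l ∈ Finset.range m, (wsh (i + 1) μ l + 1) 
      = ∑ l ∈ Finset.range m, (μ l + 1) - if m = i + 1 then 1 else 0 := by
    induction m with
    | zero => simp
    | succ m ih =>
      rw [Finset.sum_range_succ, Finset.sum_range_succ, ih]
      unfold wsh
      split_ifs <;> omega
  rw [key]
  split_ifs <;> push_cast <;> ring

section Q
variable {A : Type} [Ring A] [Algebra ℂ A] (F : ℕ → ℕ → A) (P : ℕ → A) (μ : ℕ → ℤ)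

lemma prod_mus (s k b : ℕ) (hb : b ≤ s + 1) :
    (((∏ q ∈ Finset.Icc (k + 1) (b - 1), mus μ q s : ℤ)) : ℂ)
      = ∏ q ∈ Finset.Ico (k + 1) b, (ell μ (s + 1) - ell μ q) := by
  have e : Finset.Icc (k + 1) (b - 1) = Finset.Ico (k + 1) b := by ext x; simp; omega
  rw [e]
  push_cast
  refine Finset.prod_congr rfl fun q hq => ?_
  rw [Finset.mem_Ico] at hq
  exact mus_eq _ _ _ (by omega)

lemma Q_top (s : ℕ) : Qop F μ s (s + 1) = 1 := by
  rw [Qop]; simp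

lemma Q_rec (s k : ℕ) (hk : k ≤ s) :
    Qop F μ s k = ∑ b ∈ Finset.Ico (k + 1) (s + 2), Qop F μ s b *
      ((∏ q ∈ Finset.Ico (k + 1) b, (ell μ (s + 1) - ell μ q)) • F k (b - 1)) := by
  rw [Qop, if_neg (by omega),
    Finset.sum_attach (Finset.range (s + 1 - k)) 
      (fun l => Qop F μ s (s - l + 1) * Fm F μ s k (s - l))]
  refine Finset.sum_nbij' (fun l => s - l + 1) (fun b => s + 1 - b) ?_ ?_ ?_ ?_ ?_
  · intro l hl; simp at hl ⊢; omega
  · intro l hl; simp at hl ⊢; omega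
  · intro l hl; simp at hl ⊢; omega
  · intro l hl; simp at hl ⊢; omega
  · intro l hl
    simp at hl
    rw [← prod_mus μ s k (s - l + 1) (by omega)]
    simp [Fm]

lemma G_sum (s r : ℕ) (hr : r ≤ s) :
    ∑ b ∈ Finset.Ico 1 (s + 2), Qop F μ s b * 
      ((∏ q ∈ Finset.Ico 1 b, (ell μ (s + 1) - ell μ q)) • P b) =
    ∑ b ∈ Finset.Ico (r + 1) (s + 2), Qop F μ s b * 
      ((∏ q ∈ Finset.Ico (r + 1) b, (ell μ (s + 1) - ell μ q)) • 
        G F P (ell μ) (ell μ (s + 1)) r b) := by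
  induction r with
  | zero => simp [G]
  | succ r ih =>
    rw [ih (by omega), Finset.sum_eq_sum_Ico_succ_bot (by omega)]
    rw [Q_rec F μ s (r + 1) hr]
    simp only [Finset.Ico_self, Finset.prod_empty, one_smul]
    rw [Finset.sum_mul, ← Finset.sum_add_distrib]
    refine Finset.sum_congr rfl fun b hb => ?_
    rw [Finset.mem_Ico] at hb
    rw [Finset.prod_eq_prod_Ico_succ_bot (by omega : r + 1 < b)]
    simp only [G, mul_smul_comm, smul_mul_assoc, smul_add, mul_add, mul_assoc, smul_smul]
    rw [add_comm]
    congr 2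
    ring

end Q

section Mod
variable {M : Type} [AddCommGroup M] [Module ℂ M]

lemma phi_eq (F : ℕ → ℕ → Module.End ℂ M) (P : ℕ → Module.End ℂ M) (μ : ℕ → ℤ) (s : ℕ) :
    PhiOp F P μ (s + 1) = G F P (ell μ) (ell μ (s + 1)) s (s + 1) := by
  have h1 : PhiOp F P μ (s + 1) = ∑ b ∈ Finset.Ico 1 (s + 2), Qop F μ s b * 
      ((∏ q ∈ Finset.Ico 1 b, (ell μ (s + 1) - ell μ q)) • P b) := by
    have hP : ∀ b, b ≤ s + 1 → Pm P μ (s + 1) b = 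
        (∏ q ∈ Finset.Ico 1 b, (ell μ (s + 1) - ell μ q)) • P b := by
      intro b hb
      rw [Pm]
      have := prod_mus μ s 0 b hb
      simp only [zero_add] at this
      rw [← this]; simp
    rw [Finset.sum_Ico_succ_top (by omega), Q_top, one_mul, PhiOp, hP _ le_rfl, add_comm]
    congr 1
    have e : Finset.Icc 1 (s + 1 - 1) = Finset.Ico 1 (s + 1) := by ext x; simp only [Finset.mem_Icc, Finset.mem_Ico]; omega
    rw [e]
    refine Finset.sum_congr rfl fun b hb => ?_
    rw [Finset.mem_Ico] at hb
    rw [hP _ (by omega)]; rfl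
  rw [h1, G_sum F P μ s s le_rfl]
  simp [Q_top]

variable {n : ℕ} (ρ : SLPRep n M)

lemma rel : Rel n ρ.F ρ.P where
  ff0 := by
    intro p a r b h1 h2 h3 h4 h5 h6 h7 h8
    have := ρ.hFF p (a-1) r (b-1) h1 (by omega) (by omega) h4 (by omega) (by omega)
    rw [if_neg (by omega), if_neg (by omega), Ring.lie_def, sub_zero, sub_eq_zero] at this
    exact this
  ff1 := by
    intro p a r h1 h2 h3 h4
    have := ρ.hFF p (a-1) r (p-1) (by omega) (by omega) (by omega) h1 (by omega) (by omega)
    rw [if_pos (by omega), if_neg (by omega), Ring.lie_def, sub_zero, sub_eq_iff_eq_add] at this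
    rw [this, add_comm]
  fp0 := by
    intro p a b h1 h2 h3 h4 h5 h6
    have := ρ.hFP p (a-1) b h1 (by omega) (by omega) h4 h5
    rw [if_neg h6, Ring.lie_def, sub_eq_zero] at this
    exact this
  fp1 := by
    intro p a h1 h2 h3
    have := ρ.hFP p (a-1) p h1 (by omega) (by omega) h1 (by omega)
    rw [if_pos rfl, Ring.lie_def, sub_eq_iff_eq_add, Nat.sub_add_cancel (by omega)] at this
    rw [this, add_comm]
  pp := by
    intro a b h1 h2 h3 h4
    have := ρ.hPP a b h1 h2 h3 h4
    rw [Ring.lie_def, sub_eq_zero] at this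
    exact this

lemma phi_comm_lt (μ : ℕ → ℤ) (i j : ℕ) (hi : 1 ≤ i) (hij : i < j) (hj : j ≤ n + 1) :
    PhiOp ρ.F ρ.P (wsh j μ) i * PhiOp ρ.F ρ.P μ j = 
      PhiOp ρ.F ρ.P (wsh i μ) j * PhiOp ρ.F ρ.P μ i := by
  obtain ⟨i, rfl⟩ := Nat.exists_eq_add_of_le' hi
  obtain ⟨j, rfl⟩ := Nat.exists_eq_add_of_le' (show 1 ≤ j by omega)
  rw [phi_eq, phi_eq, phi_eq, phi_eq, G_congr (ell (wsh (j+1) μ)) (ell μ)]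
  · have e1 : ell (wsh (j+1) μ) (i+1) = ell μ (i+1) := by rw [ell_wsh]; simp; omega
    have e2 : ell (wsh (i+1) μ) (j+1) = ell μ (j+1) := by rw [ell_wsh]; simp; omega
    rw [e1, e2]
    exact comm_lev (rel ρ) (ell μ) _ i _ (ell_wsh μ i) j (by omega) (j+1) (by omega) hj
  · intro m hm; rw [ell_wsh]; simp; omega

lemma wsh_comm (μ : ℕ → ℤ) (i j : ℕ) : wsh i (wsh j μ) = wsh j (wsh i μ) := by
  funext l; unfold wsh; ring

lemma phi_comm (μ : ℕ → ℤ) (i j : ℕ) (hi : 1 ≤ i) (hi' : i ≤ n + 1) (hj : 1 ≤ j)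
    (hj' : j ≤ n + 1) (v : M) :
    PhiOp ρ.F ρ.P (wsh j μ) i (PhiOp ρ.F ρ.P μ j v) = 
      PhiOp ρ.F ρ.P (wsh i μ) j (PhiOp ρ.F ρ.P μ i v) := by
  rcases lt_trichotomy i j with h | h | h
  · exact LinearMap.congr_fun (phi_comm_lt ρ μ i j hi h hj') v
  · subst h; rfl
  · exact (LinearMap.congr_fun (phi_comm_lt ρ μ j i hj h hi') v).symm

lemma phiList_perm {L L' : List ℕ} (hp : L.Perm L') : ∀ (_ : ∀ x ∈ L, 1 ≤ x ∧ x ≤ n + 1)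
    (μ : ℕ → ℤ) (v : M), phiList ρ.F ρ.P L μ v = phiList ρ.F ρ.P L' μ v := by
  induction hp with
  | nil => intros; rfl
  | cons x _ ih =>
    intro h μ v
    exact ih (fun y hy => h y (List.mem_cons_of_mem _ hy)) _ _
  | swap x y L =>
    intro h μ v
    have hx := h x (by simp)
    have hy := h y (by simp)
    simp only [phiList]
    rw [phi_comm ρ μ x y hx.1 hx.2 hy.1 hy.2, wsh_comm]
  | trans p1 p2 ih1 ih2 =>
    intro h μ v
    rw [ih1 h, ih2 (fun x hx => h x (p1.mem_iff.2 hx))]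

lemma phiList_zero (F : ℕ → ℕ → Module.End ℂ M) (P : ℕ → Module.End ℂ M) (L : List ℕ) :
    ∀ μ, phiList F P L μ 0 = 0 := by
  induction L with
  | nil => intro μ; rfl
  | cons a L ih => intro μ; simp only [phiList, map_zero]; exact ih _

lemma phiList_append_zero (F : ℕ → ℕ → Module.End ℂ M) (P : ℕ → Module.End ℂ M) (L L' : List ℕ) :
    ∀ μ v, phiList F P L μ v = 0 → phiList F P (L ++ L') μ v = 0 := by
  induction L with
  | nil => 
    intro μ v h
    change v = 0 at h
    rw [h]; exact phiList_zero F P _ _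
  | cons a L ih => intro μ v h; exact ih _ _ h

lemma H_lev (l : ℕ → ℂ) (t : ℂ) (i : ℕ) (hi : 1 ≤ i) (hi' : i ≤ n) (r : ℕ) : ∀ b, r < b → b ≤ n + 1 →
    ρ.H i * G ρ.F ρ.P l t r b = G ρ.F ρ.P l t r b * ρ.H i + 
      (((if i = b then 1 else 0) - (if i + 1 = b then 1 else 0) : ℤ) : ℂ) • G ρ.F ρ.P l t r b := by
  induction r with
  | zero =>
    intro b h1 h2
    have := ρ.hHP i b hi hi' h1 h2
    rw [Ring.lie_def, sub_eq_iff_eq_add, add_comm] at this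
    exact this
  | succ r ih =>
    intro b h1 h2
    have e1 := ih b (by omega) h2
    have e2 := ih (r+1) (by omega) (by omega)
    have e3 := ρ.hHF i (r+1) (b-1) hi hi' (by omega) (by omega) (by omega)
    rw [Ring.lie_def, sub_eq_iff_eq_add] at e3
    have e4 : pair i (r+1) (b-1) = ((if i = r+1 then 1 else 0) - (if i + 1 = r+1 then 1 else 0))
        - ((if i = b then 1 else 0) - (if i + 1 = b then 1 else 0)) := by
      unfold pair; split_ifs <;> omega
    rw [e4] at e3
    simp only [G]
    rw [mul_add, mul_smul_comm, e1, ← mul_assoc, e3, add_mul, mul_assoc, e2]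
    simp only [mul_add, add_mul, smul_mul_assoc, mul_smul_comm, mul_assoc]
    generalize (if i = b then (1 : ℤ) else 0) - (if i + 1 = b then 1 else 0) = x
    generalize (if i = r + 1 then (1 : ℤ) else 0) - (if i + 1 = r + 1 then 1 else 0) = y
    push_cast
    module

lemma E_lev1 (l : ℕ → ℂ) (t : ℂ) (i : ℕ) (hi : 1 ≤ i) (hi' : i ≤ n) (r : ℕ) : r < i →
    ∀ b, r < b → b ≤ n + 1 →
    ρ.E i i * G ρ.F ρ.P l t r b = G ρ.F ρ.P l t r b * ρ.E i i + 
      if i + 1 = b then G ρ.F ρ.P l t r i else 0 := by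
  induction r with
  | zero =>
    intro h0 b h1 h2
    have := ρ.hEP i i b hi le_rfl hi' h1 h2
    rw [Ring.lie_def, sub_eq_iff_eq_add, add_comm] at this
    exact this
  | succ r ih =>
    intro h0 b h1 h2
    have e1 := ih (by omega) b (by omega) h2
    have e2 := ih (by omega) (r+1) (by omega) (by omega)
    rw [if_neg (by omega), add_zero] at e2
    have e3 := ρ.hEF i i (r+1) (b-1) hi le_rfl hi' (by omega) (by omega) (by omega)
    rw [if_neg (by omega), if_neg (by omega), if_neg (by omega), if_neg (by omega),
      Ring.lie_def, sub_eq_iff_eq_add] at e3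
    simp only [G]
    by_cases hb : i + 1 = b
    · rw [if_pos (by omega)] at e3
      rw [if_pos hb] at e1 ⊢
      rw [mul_add, mul_smul_comm, e1, ← mul_assoc, e3, add_mul, mul_assoc, e2]
      simp only [mul_add, add_mul, smul_mul_assoc, mul_assoc, zero_mul]
      module
    · rw [if_neg (by omega)] at e3
      rw [if_neg hb] at e1 ⊢
      rw [mul_add, mul_smul_comm, e1, ← mul_assoc, e3, add_mul, mul_assoc, e2]
      simp only [mul_add, add_mul, smul_mul_assoc, mul_assoc, zero_mul]
      module

def SHW (μ : ℕ → ℤ) (u : M) : Prop :=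
  ∀ i, 1 ≤ i → i ≤ n → ρ.H i u = ((μ i : ℤ) : ℂ) • u ∧ ρ.E i i u = 0

variable {ρ}

lemma E_low {μ : ℕ → ℤ} {u : M} (h : SHW ρ μ u) (l : ℕ → ℂ) (t : ℂ) (i : ℕ) (hi : 1 ≤ i)
    (hi' : i ≤ n) (r b : ℕ) (hr : r < i) (hb : r < b) (hb' : b ≤ n + 1) :
    ρ.E i i (G ρ.F ρ.P l t r b u) = if i + 1 = b then G ρ.F ρ.P l t r i u else 0 := by
  have := LinearMap.congr_fun (E_lev1 ρ l t i hi hi' r hr b hb hb') u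
  simp only [Module.End.mul_apply, LinearMap.add_apply, (h i hi hi').2, map_zero, zero_add] at this
  rw [this]; split_ifs <;> rfl

lemma H_vec {μ : ℕ → ℤ} {u : M} (h : SHW ρ μ u) (l : ℕ → ℂ) (t : ℂ) (i : ℕ) (hi : 1 ≤ i)
    (hi' : i ≤ n) (r b : ℕ) (hb : r < b) (hb' : b ≤ n + 1) :
    ρ.H i (G ρ.F ρ.P l t r b u) = ((wsh b μ i : ℤ) : ℂ) • G ρ.F ρ.P l t r b u := by
  have := LinearMap.congr_fun (H_lev ρ l t i hi hi' r b hb hb') u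
  simp only [Module.End.mul_apply, LinearMap.add_apply, (h i hi hi').1, map_smul,
    LinearMap.smul_apply] at this
  rw [this, ← add_smul, wsh]
  congr 1
  push_cast
  ring

lemma E_mid {μ : ℕ → ℤ} {u : M} (h : SHW ρ μ u) (l : ℕ → ℂ) (t : ℂ) (i : ℕ)
    (hi' : i + 1 ≤ n) (b : ℕ) (hb : i + 1 < b) (hb' : b ≤ n + 1) :
    ρ.E (i+1) (i+1) (G ρ.F ρ.P l t (i+1) b u) = 
      if i + 2 = b then (t - l (i+1) + (μ (i+1) + 1)) • G ρ.F ρ.P l t i (i+1) u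
      else - ρ.F (i+2) (b-1) (G ρ.F ρ.P l t i (i+1) u) := by
  have e1 := E_low h l t (i+1) (by omega) hi' i b (by omega) (by omega) hb'
  have e2 := E_low h l t (i+1) (by omega) hi' i (i+1) (by omega) (by omega) (by omega)
  have e4 := H_vec h l t (i+1) (by omega) hi' i (i+1) (by omega) (by omega)
  rw [if_neg (by omega)] at e2
  have e3 := ρ.hEF (i+1) (i+1) (i+1) (b-1) (by omega) le_rfl hi' (by omega) (by omega) (by omega)
  simp only [G, LinearMap.add_apply, LinearMap.smul_apply, map_add, map_smul,
    Module.End.mul_apply]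
  rw [e1]
  by_cases hbb : i + 2 = b
  · rw [if_pos (by omega), if_neg (by omega), if_neg (by omega), if_neg (by omega),
      if_neg (by omega), Ring.lie_def, sub_eq_iff_eq_add] at e3
    have := LinearMap.congr_fun e3 (G ρ.F ρ.P l t i (i+1) u)
    simp only [Module.End.mul_apply, LinearMap.add_apply, LinearMap.zero_apply, e2, map_zero,
      add_zero] at this
    rw [this, if_pos hbb, if_pos hbb]
    have hw : wsh (i+1) μ (i+1) = μ (i+1) + 1 := by unfold wsh; simp
    simp only [Finset.Icc_self, Finset.sum_singleton]
    rw [e4, hw]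
    push_cast
    module
  · rw [if_neg (by omega), if_pos (by omega), if_neg (by omega), if_neg (by omega),
      if_neg (by omega), Ring.lie_def, sub_eq_iff_eq_add] at e3
    have := LinearMap.congr_fun e3 (G ρ.F ρ.P l t i (i+1) u)
    simp only [Module.End.mul_apply, LinearMap.add_apply, LinearMap.zero_apply, e2, map_zero,
      add_zero, zero_add, LinearMap.neg_apply] at this
    rw [this, if_neg hbb, if_neg hbb, smul_zero, zero_add]

lemma EF_comm (i p b : ℕ) (hi : 1 ≤ i) (hp : i < p) (hb : p < b) (hb' : b ≤ n + 1) (w : M) :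
    ρ.E i i (ρ.F p (b-1) w) = ρ.F p (b-1) (ρ.E i i w) := by
  have e3 := ρ.hEF i i p (b-1) hi le_rfl (by omega) (by omega) (by omega) (by omega)
  rw [if_neg (by omega), if_neg (by omega), if_neg (by omega), if_neg (by omega),
      if_neg (by omega), Ring.lie_def, sub_eq_iff_eq_add] at e3
  simpa using LinearMap.congr_fun e3 w

lemma E_high {μ : ℕ → ℤ} {u : M} (h : SHW ρ μ u) (t : ℂ) (i : ℕ)
    (hi' : i + 1 ≤ n) (r : ℕ) (hr : i + 2 ≤ r) : ∀ b, r < b → b ≤ n + 1 →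
    ρ.E (i+1) (i+1) (G ρ.F ρ.P (ell μ) t r b u) = 0 := by
  induction r, hr using Nat.le_induction with
  | base =>
    intro b hb hb'
    have e1 := E_mid h (ell μ) t i hi' b (by omega) hb'
    have e2 := E_mid h (ell μ) t i hi' (i+2) (by omega) (by omega)
    rw [if_neg (by omega)] at e1
    rw [if_pos rfl] at e2
    rw [G]
    simp only [LinearMap.add_apply, LinearMap.smul_apply, map_add, map_smul,
      Module.End.mul_apply]
    rw [EF_comm (i+1) (i+1+1) b (by omega) (by omega) (by omega) hb', e1, e2, map_smul]
    have hl : ell μ (i+1+1) = ell μ (i+1) - (μ (i+1) + 1) := by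
      unfold ell; rw [Finset.sum_range_succ _ (i+1)]; push_cast; ring
    rw [hl]
    module
  | succ r hr ih =>
    intro b hb hb'
    rw [G]
    simp only [LinearMap.add_apply, LinearMap.smul_apply, map_add, map_smul,
      Module.End.mul_apply]
    rw [EF_comm (i+1) (r+1) b (by omega) (by omega) (by omega) hb', ih b (by omega) hb',
      ih (r+1) (by omega) (by omega)]
    simp

lemma shw_phi {μ : ℕ → ℤ} {u : M} (h : SHW ρ μ u) (j : ℕ) (hj : 1 ≤ j) (hj' : j ≤ n + 1) :
    SHW ρ (wsh j μ) (PhiOp ρ.F ρ.P μ j u) := by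
  obtain ⟨j, rfl⟩ := Nat.exists_eq_add_of_le' hj
  intro i hi hi'
  rw [phi_eq]
  refine ⟨H_vec h _ _ i hi hi' _ _ (by omega) hj', ?_⟩
  rcases lt_trichotomy i j with hij | hij | hij
  · obtain ⟨i, rfl⟩ := Nat.exists_eq_add_of_le' hi
    exact E_high h _ i hi' j (by omega) (j+1) (by omega) hj'
  · subst hij
    obtain ⟨i, rfl⟩ := Nat.exists_eq_add_of_le' hi
    rw [E_mid h _ _ i hi' _ (by omega) hj', if_pos rfl]
    have hl : ell μ (i+1+1) = ell μ (i+1) - (μ (i+1) + 1) := by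
      unfold ell; rw [Finset.sum_range_succ _ (i+1)]; push_cast; ring
    rw [hl]
    module
  · rw [E_low h _ _ i hi hi' j (j+1) hij (by omega) hj', if_neg (by omega)]

lemma shw_neg [FiniteDimensional ℂ M] {μ : ℕ → ℤ} {u : M} (h : SHW ρ μ u) (i : ℕ) (hi : 1 ≤ i)
    (hi' : i ≤ n) (hneg : μ i < 0) : u = 0 := by
  by_contra hu
  obtain ⟨h1, h2⟩ := h i hi hi'
  letI : LieRing (Module.End ℂ M) := LieRing.ofAssociativeRing
  have t : IsSl2Triple (ρ.H i) (ρ.E i i) (ρ.F i i) := by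
    refine ⟨?_, ?_, ?_, ?_⟩
    · intro h0
      rw [h0, LinearMap.zero_apply, eq_comm, smul_eq_zero] at h1
      rcases h1 with h1 | h1
      · have : μ i = 0 := by exact_mod_cast h1
        omega
      · exact hu h1
    · rw [ρ.hEF i i i i hi le_rfl hi' hi le_rfl hi']; simp
    · rw [ρ.hHE i i i hi hi' hi le_rfl hi', pair]; simp; norm_num [two_smul, two_mul]
    · rw [ρ.hHF i i i hi hi' hi le_rfl hi', pair]; simp; norm_num [two_smul, two_mul]
  have pv : t.HasPrimitiveVectorWith u ((μ i : ℤ) : ℂ) := ⟨hu, h1, h2⟩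
  obtain ⟨m, hm⟩ := pv.exists_nat
  have : μ i = m := by exact_mod_cast hm
  omega

lemma phi_rep_zero [FiniteDimensional ℂ M] (k : ℕ) (hk : 1 ≤ k) (hk' : k ≤ n) (m : ℕ) :
    ∀ (μ : ℕ → ℤ) (u : M), SHW ρ μ u → μ k < m →
      phiList ρ.F ρ.P (List.replicate m (k+1)) μ u = 0 := by
  induction m with
  | zero => 
    intro μ u h hm
    exact shw_neg h k hk hk' (by simpa using hm)
  | succ m ih =>
    intro μ u h hm
    rw [List.replicate_succ, phiList]
    apply ih _ _ (shw_phi h (k+1) (by omega) (by omega))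
    unfold wsh
    simp
    push_cast at hm
    omega

end Mod

lemma evec_mem (k : ℕ) (iv : ℕ → ℕ) (x : ℕ) (hx : x ∈ evec k iv) : 1 ≤ x ∧ x < k := by
  unfold evec at hx
  simp only [List.mem_flatMap, List.mem_range, List.mem_replicate] at hx
  obtain ⟨a, ha, -, rfl⟩ := hx
  omega

lemma evec_perm (k : ℕ) (iv jv : ℕ → ℕ) (h : ∀ l, jv l ≤ iv l) :
    (evec k jv ++ evec k (fun l => iv l - jv l)).Perm (evec k iv) := by
  unfold evec
  refine (List.flatMap_append_perm _ _ _).trans (List.Perm.of_eq ?_)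
  congr 1
  funext t
  rw [List.replicate_append_replicate, Nat.add_sub_cancel' (h _)]

end Pf

open Paper in
/-- Theorem 3.24: properties of the numbers `J_k^μ(i_1,…,i_{k-1})` for a
cyclic module generated by a highest weight vector `v_μ`: (a) `J_1^μ ≥ 1`; (b) the set of
all of them is bounded; (c) they are weakly decreasing in each argument; and (d)
`1 ≤ J_k^μ(i_1,…,i_{k-1}) ≤ μ_{k-1} + 1` for `2 ≤ k ≤ n+1`.  (Admissibility of the
exponents `i_h < J_h^μ(i_1,…,i_{h-1})` is encoded as the nonvanishing of
`φ_{k-1}^{i_{k-1}}(⋯(φ_1^{i_1}(v_μ))⋯)`.) -/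
theorem stmt_17 (n : ℕ) (M : Type) [AddCommGroup M] [Module ℂ M] [FiniteDimensional ℂ M]
    (ρ : SLPRep n M) (μ : ℕ → ℤ) (hdom : ∀ l, 1 ≤ l → l ≤ n → 0 ≤ μ l)
    (v : M) (hv : IsHWvec n ρ.H ρ.E μ v) (hv0 : v ≠ 0)
    (hcyc : gGen n ρ.H ρ.E ρ.F ρ.P v = ⊤) :
    (∀ J, Jmin ρ.F ρ.P μ v 1 (fun _ => 0) J → 1 ≤ J) ∧
    (∃ B : ℕ, ∀ k iv J, 1 ≤ k → k ≤ n + 1 →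
      vIter ρ.F ρ.P μ v k iv ≠ 0 → Jmin ρ.F ρ.P μ v k iv J → J ≤ B) ∧
    (∀ k iv jv J J', 1 ≤ k → k ≤ n + 1 → (∀ l, jv l ≤ iv l) →
      vIter ρ.F ρ.P μ v k iv ≠ 0 → vIter ρ.F ρ.P μ v k jv ≠ 0 →
      Jmin ρ.F ρ.P μ v k iv J → Jmin ρ.F ρ.P μ v k jv J' → J ≤ J') ∧
    (∀ k iv J, 2 ≤ k → k ≤ n + 1 →
      vIter ρ.F ρ.P μ v k iv ≠ 0 → Jmin ρ.F ρ.P μ v k iv J →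
      1 ≤ J ∧ (J : ℤ) ≤ μ (k - 1) + 1) := by
  have hs : Pf.SHW ρ μ v := fun i h1 h2 => ⟨hv.1 i h1 h2, hv.2 i i h1 le_rfl h2⟩
  have hd : ∀ k iv J, 2 ≤ k → k ≤ n + 1 → Jmin ρ.F ρ.P μ v k iv J →
      1 ≤ J ∧ (J : ℤ) ≤ μ (k - 1) + 1 := by
    intro k iv J h1 h2 hJ
    refine ⟨hJ.1, ?_⟩
    by_contra hlt
    have hpos := hdom (k - 1) (by omega) (by omega)
    obtain ⟨m, hm⟩ := Int.eq_ofNat_of_zero_le hpos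
    refine hJ.2.2 (m + 1) (by omega) (by omega) ?_
    unfold vIterJ
    rw [Pf.phiList_perm ρ (List.perm_append_comm)]
    · apply Pf.phiList_append_zero
      obtain ⟨k, rfl⟩ := Nat.exists_eq_add_of_le' (show 1 ≤ k by omega)
      rw [Nat.add_sub_cancel] at hm
      exact Pf.phi_rep_zero k (by omega) (by omega) (m + 1) μ v hs (by omega)
    · intro x hx
      rw [List.mem_append, List.mem_replicate] at hx
      rcases hx with hx | hx
      · have := Pf.evec_mem k iv x hx; omega
      · omega
  refine ⟨fun J hJ => hJ.1, ?_, ?_, fun k iv J h1 h2 _ hJ => hd k iv J h1 h2 hJ⟩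
  · have hb : ∃ B1 : ℕ, ∀ iv J, Jmin ρ.F ρ.P μ v 1 iv J → J ≤ B1 := by
      by_cases he : ∃ iv J, Jmin ρ.F ρ.P μ v 1 iv J
      · obtain ⟨iv, J, hJ⟩ := he
        refine ⟨J, fun iv' J' hJ' => ?_⟩
        by_contra hlt
        exact hJ'.2.2 J hJ.1 (by omega) hJ.2.1
      · exact ⟨0, fun iv J hJ => (he ⟨iv, J, hJ⟩).elim⟩
    obtain ⟨B1, hB1⟩ := hb
    refine ⟨B1 + ∑ l ∈ Finset.range (n + 1), ((μ l).toNat + 1), fun k iv J h1 h2 _ hJ => ?_⟩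
    rcases Nat.lt_or_ge k 2 with hk | hk
    · obtain rfl : k = 1 := by omega
      exact (hB1 iv J hJ).trans (Nat.le_add_right _ _)
    · have h3 := (hd k iv J hk h2 hJ).2
      have h4 := Finset.single_le_sum (f := fun l => (μ l).toNat + 1) (s := Finset.range (n + 1))
        (fun _ _ => Nat.zero_le _) (Finset.mem_range.2 (show k - 1 < n + 1 by omega))
      omega
  · intro k iv jv J J' h1 h2 hle _ _ hJ hJ'
    by_contra hlt
    refine hJ.2.2 J' hJ'.1 (by omega) ?_
    have hz := hJ'.2.1
    unfold vIterJ at hz ⊢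
    have hp : (evec k iv ++ List.replicate J' k).Perm
        ((evec k jv ++ List.replicate J' k) ++ evec k (fun l => iv l - jv l)) := by
      refine ((Pf.evec_perm k iv jv hle).symm.append_right _).trans ?_
      rw [List.append_assoc, List.append_assoc]
      exact List.perm_append_comm.append_left _
    rw [Pf.phiList_perm ρ hp]
    · exact Pf.phiList_append_zero _ _ _ _ _ _ hz
    · intro x hx
      rw [List.mem_append, List.mem_replicate] at hx
      rcases hx with hx | hx
      · have := Pf.evec_mem k iv x hx; omega
      · omega
end
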